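/- arXiv:2503.07145 — 3 statements merged into one kernel-verified Lean document; each statement's English description precedes it below -/
import Mathlib

section
/- Let ρ and μ be Borel probability measures on ℝ^d with finite first moment. Then ρ ≼_C μ in convex order (∫φ dρ ≤ ∫φ dμ for every convex φ : ℝ^d → ℝ) if and only if there exists a Borel probability measure π on ℝ^d × ℝ^d whose first marginal is ρ, whose second marginal is μ, and which is a martingale coupling, i.e. ∫ f(x)(y − x) dπ(x,y) = 0 (componentwise, in ℝ^d) for every bounded Borel measurable f : ℝ^d → ℝ. -/
open MeasureTheory

/-- A finite convex function on a finite-dimensional space has an affine minorant. -/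
lemma ConvexOn.exists_affine_le {E : Type*} [NormedAddCommGroup E] [NormedSpace ℝ E]
    [FiniteDimensional ℝ E] {φ : E → ℝ} (hφ : ConvexOn ℝ Set.univ φ) :
    ∃ (l : E →L[ℝ] ℝ) (c : ℝ), ∀ x, l x + c ≤ φ x := by
  have hcont : LowerSemicontinuousOn φ Set.univ :=
    (hφ.continuousOn isOpen_univ).lowerSemicontinuousOn
  obtain ⟨l, c, hle, -⟩ := hφ.exists_affine_le_of_lt (𝕜 := ℝ) (Set.mem_univ (0 : E))
    (sub_one_lt (φ 0)) isClosed_univ hcont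
  exact ⟨l, c, fun x => hle ⟨x, Set.mem_univ x⟩⟩

/-- The first projection is a version of the conditional expectation of the second projection
under a martingale coupling. -/
lemma condExp_snd_ae_eq_fst_of_martingale {ι : Type*} [Fintype ι]
    {π : Measure ((ι → ℝ) × (ι → ℝ))} [IsFiniteMeasure π]
    (h1 : Integrable Prod.fst π) (h2 : Integrable Prod.snd π)
    (hm : ∀ f : (ι → ℝ) → ℝ, Measurable f → (∃ C : ℝ, ∀ x, |f x| ≤ C) →
      ∀ i, ∫ p, f p.1 * (p.2 i - p.1 i) ∂π = 0) :
    Prod.fst =ᵐ[π] π[Prod.snd | MeasurableSpace.comap Prod.fst inferInstance] := by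
  refine ae_eq_condExp_of_forall_setIntegral_eq measurable_fst.comap_le h2
    (fun s _ _ => h1.integrableOn) ?_ ?_
  · rintro _ ⟨A, hA, rfl⟩ -
    ext i
    rw [eval_integral (fun i => (h1.eval i).integrableOn),
      eval_integral (fun i => (h2.eval i).integrableOn), eq_comm, ← sub_eq_zero,
      ← integral_sub (h2.eval i).integrableOn (h1.eval i).integrableOn,
      ← integral_indicator (measurable_fst hA),
      ← hm (A.indicator 1) (measurable_one.indicator hA) ⟨1, fun x => ?_⟩ i]
    · refine integral_congr_ae (Filter.Eventually.of_forall fun p => ?_)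
      by_cases hp : p.1 ∈ A <;> simp [hp]
    · by_cases hx : x ∈ A <;> simp [hx]
  · exact (comap_measurable Prod.fst).aestronglyMeasurable

/-- Jensen's inequality along a martingale coupling. -/
lemma integral_le_of_martingale {ι : Type*} [Fintype ι]
    {π : Measure ((ι → ℝ) × (ι → ℝ))} [IsFiniteMeasure π]
    (h1 : Integrable Prod.fst π) (h2 : Integrable Prod.snd π)
    (hm : ∀ f : (ι → ℝ) → ℝ, Measurable f → (∃ C : ℝ, ∀ x, |f x| ≤ C) →
      ∀ i, ∫ p, f p.1 * (p.2 i - p.1 i) ∂π = 0)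
    {φ : (ι → ℝ) → ℝ} (hφ : ConvexOn ℝ Set.univ φ) (hint : Integrable (fun p => φ p.2) π) :
    Integrable (fun p => φ p.1) π ∧ ∫ p, φ p.1 ∂π ≤ ∫ p, φ p.2 ∂π := by
  have hle : ∀ᵐ p ∂π, φ p.1 ≤
      (π[fun p => φ p.2 | MeasurableSpace.comap Prod.fst inferInstance]) p := by
    filter_upwards [condExp_snd_ae_eq_fst_of_martingale h1 h2 hm,
      hφ.map_condExp_le_of_finiteDimensional
        (m := MeasurableSpace.comap Prod.fst inferInstance) measurable_fst.comap_le h2 hint]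
      with p hp hq
    rw [hp]
    exact hq
  obtain ⟨l, c, hlc⟩ := hφ.exists_affine_le
  have hcont : Continuous φ := continuousOn_univ.1 (hφ.continuousOn isOpen_univ)
  have hφ1 : Integrable (fun p : (ι → ℝ) × (ι → ℝ) => φ p.1) π :=
    integrable_of_le_of_le (hcont.comp continuous_fst).aestronglyMeasurable
      (Filter.Eventually.of_forall fun p => hlc p.1) hle
      ((l.integrable_comp h1).add (integrable_const c)) integrable_condExp
  refine ⟨hφ1, (integral_mono_ae hφ1 integrable_condExp hle).trans_eq ?_⟩
  exact integral_condExp measurable_fst.comap_le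

/-- Superhedging inequality: if a semi-static position is nonnegative, so is its price. -/
lemma integral_add_integral_nonneg_of_convexOrder {ι : Type*} [Fintype ι]
    {ρ μ : Measure (ι → ℝ)} [IsFiniteMeasure μ]
    (hμ : Integrable (fun x => ‖x‖) μ)
    (h : ∀ φ : (ι → ℝ) → ℝ, ConvexOn ℝ Set.univ φ → Integrable φ μ →
      Integrable φ ρ ∧ ∫ x, φ x ∂ρ ≤ ∫ x, φ x ∂μ)
    {ψ φ : (ι → ℝ) → ℝ} (b : ι → (ι → ℝ) → ℝ) (hψ : Integrable ψ ρ) (hφ : Integrable φ μ)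
    (hpos : ∀ x y, 0 ≤ ψ x + φ y + ∑ i, b i x * (y i - x i)) :
    0 ≤ ∫ x, ψ x ∂ρ + ∫ y, φ y ∂μ := by
  set u : (ι → ℝ) → (ι → ℝ) → ℝ := fun x y => -ψ x - ∑ i, b i x * (y i - x i) with hu
  have hbdd (y) : BddAbove (Set.range fun x => u x y) := by
    refine ⟨φ y, ?_⟩
    rintro _ ⟨x, rfl⟩
    have := hpos x y
    simp only [hu]
    linarith
  have hle_iSup (x y) : u x y ≤ ⨆ x, u x y := le_ciSup (hbdd y) x
  have hiSup_le (y) : ⨆ x, u x y ≤ φ y := ciSup_le fun x => by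
    have := hpos x y
    simp only [hu]
    linarith
  have hdiag (x) : -ψ x ≤ ⨆ z, u z x := by simpa [hu] using hle_iSup x x
  have hconv : ConvexOn ℝ Set.univ fun y => ⨆ x, u x y := by
    refine ⟨convex_univ, fun y _ z _ s t hs ht hst => ciSup_le fun x => ?_⟩
    have hux : u x (s • y + t • z) = s * u x y + t * u x z := by
      have : ∑ i, b i x * ((s • y + t • z) i - x i) =
          s * ∑ i, b i x * (y i - x i) + t * ∑ i, b i x * (z i - x i) := by
        rw [Finset.mul_sum, Finset.mul_sum, ← Finset.sum_add_distrib]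
        refine Finset.sum_congr rfl fun i _ => ?_
        simp only [Pi.add_apply, Pi.smul_apply, smul_eq_mul]
        linear_combination (b i x * x i) * hst
      simp only [hu, this]
      linear_combination (ψ x) * hst
    rw [hux, smul_eq_mul, smul_eq_mul]
    gcongr <;> exact hle_iSup _ _
  obtain ⟨l, c, hlc⟩ := hconv.exists_affine_le
  have hid : Integrable (fun y : ι → ℝ => y) μ :=
    (integrable_norm_iff measurable_id.aestronglyMeasurable).1 hμ
  have hint : Integrable (fun y => ⨆ x, u x y) μ :=
    integrable_of_le_of_le
      (continuousOn_univ.1 (hconv.continuousOn isOpen_univ)).aestronglyMeasurable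
      (Filter.Eventually.of_forall hlc) (Filter.Eventually.of_forall hiSup_le)
      ((l.integrable_comp hid).add (integrable_const c)) hφ
  obtain ⟨hint', hle⟩ := h _ hconv hint
  have h1 : ∫ x, -ψ x ∂ρ ≤ ∫ x, ⨆ z, u z x ∂ρ := integral_mono hψ.neg hint' hdiag
  have h2 : ∫ y, ⨆ x, u x y ∂μ ≤ ∫ y, φ y ∂μ := integral_mono hint hφ hiSup_le
  rw [integral_neg] at h1
  linarith

/-- The real functions of at most linear growth on a seminormed space. -/
def linearGrowth (E : Type*) [SeminormedAddCommGroup E] : Submodule ℝ (E → ℝ) where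
  carrier := {g | ∃ C : ℝ, ∀ x, |g x| ≤ C * (1 + ‖x‖)}
  zero_mem' := ⟨0, fun x => by simp⟩
  add_mem' := by
    rintro f g ⟨C, hC⟩ ⟨D, hD⟩
    exact ⟨C + D, fun x => (abs_add_le _ _).trans (by linarith [hC x, hD x])⟩
  smul_mem' := by
    rintro a f ⟨C, hC⟩
    refine ⟨|a| * C, fun x => ?_⟩
    rw [Pi.smul_apply, smul_eq_mul, abs_mul, mul_assoc]
    exact mul_le_mul_of_nonneg_left (hC x) (abs_nonneg a)

lemma mem_linearGrowth_of_abs_le {E : Type*} [SeminormedAddCommGroup E] {f g : E → ℝ}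
    (hg : g ∈ linearGrowth E) (h : ∀ x, |f x| ≤ |g x|) : f ∈ linearGrowth E :=
  let ⟨C, hC⟩ := hg
  ⟨C, fun x => (h x).trans (hC x)⟩

lemma mem_linearGrowth_of_bounded {E : Type*} [SeminormedAddCommGroup E] {f : E → ℝ} {C : ℝ}
    (h : ∀ x, |f x| ≤ C) : f ∈ linearGrowth E :=
  ⟨C, fun x => (h x).trans (le_mul_of_one_le_right ((abs_nonneg _).trans (h x))
    (le_add_of_nonneg_right (norm_nonneg x)))⟩

/-- The cutoff `max 0 (min 1 (r + 1 - ‖x‖))`. -/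
noncomputable def normCutoff {E : Type*} [Norm E] (r : ℝ) (x : E) : ℝ :=
  max 0 (min 1 (r + 1 - ‖x‖))

section normCutoff

variable {E : Type*} [SeminormedAddCommGroup E] {r : ℝ} {x : E}

lemma normCutoff_nonneg : 0 ≤ normCutoff r x := le_max_left _ _

lemma normCutoff_le_one : normCutoff r x ≤ 1 := max_le zero_le_one (min_le_left _ _)

lemma normCutoff_eq_one (h : ‖x‖ ≤ r) : normCutoff r x = 1 := by
  rw [normCutoff, min_eq_left (by linarith), max_eq_right zero_le_one]

lemma normCutoff_eq_zero (h : r + 1 ≤ ‖x‖) : normCutoff r x = 0 :=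
  max_eq_left (min_le_of_right_le (by linarith))

lemma continuous_normCutoff : Continuous (normCutoff r : E → ℝ) := by
  unfold normCutoff
  fun_prop

lemma hasCompactSupport_mul_normCutoff [ProperSpace E] (g : E → ℝ) :
    HasCompactSupport fun x => g x * normCutoff r x := by
  refine HasCompactSupport.intro (isCompact_closedBall 0 (r + 1)) fun x hx => ?_
  rw [mem_closedBall_zero_iff, not_le] at hx
  rw [normCutoff_eq_zero hx.le, mul_zero]

end normCutoff

open CompactlySupported in
/-- A positive functional on the functions of linear growth which is tight, in the sense that
it is small on functions dominated by `1 + ‖x‖` outside a large ball, is the integral against a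
measure on continuous functions of linear growth. -/
lemma exists_measure_of_positive_of_tight {E : Type*} [NormedAddCommGroup E] [ProperSpace E]
    [MeasurableSpace E] [BorelSpace E] (L : linearGrowth E →ₗ[ℝ] ℝ)
    (hL : ∀ g : linearGrowth E, (∀ x, 0 ≤ g.1 x) → 0 ≤ L g) {ε : ℕ → ℝ}
    (hε : Filter.Tendsto ε Filter.atTop (nhds 0))
    (htight : ∀ (n : ℕ) (g : linearGrowth E),
      (∀ x, g.1 x ≤ if ‖x‖ ≤ n then 0 else 1 + ‖x‖) → L g ≤ ε n) :
    ∃ π : Measure E, ∀ g : linearGrowth E, Continuous g.1 →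
      Integrable g.1 π ∧ ∫ x, g.1 x ∂π = L g := by
  have hmono (f g : linearGrowth E) (h : ∀ x, f.1 x ≤ g.1 x) : L f ≤ L g := by
    rw [← sub_nonneg, ← map_sub]
    exact hL _ fun x => sub_nonneg.2 (h x)
  have hcs (g : C_c(E, ℝ)) : (g : E → ℝ) ∈ linearGrowth E := by
    obtain ⟨C, hC⟩ := g.hasCompactSupport.exists_bound_of_continuous g.continuous
    exact mem_linearGrowth_of_bounded hC
  let Λ₀ : C_c(E, ℝ) →ₗ[ℝ] ℝ :=
    { toFun := fun g => L ⟨g, hcs g⟩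
      map_add' := fun f g => (map_add L ⟨f, hcs f⟩ ⟨g, hcs g⟩)
      map_smul' := fun a g => (map_smul L a ⟨g, hcs g⟩) }
  let Λ : C_c(E, ℝ) →ₚ[ℝ] ℝ := PositiveLinearMap.mk₀ Λ₀ fun g hg => hL ⟨g, hcs g⟩ fun x => hg x
  set π := RealRMK.rieszMeasure Λ
  have hcut (n : ℕ) (g : linearGrowth E) :
      (fun x => g.1 x * normCutoff (n : ℝ) x) ∈ linearGrowth E := by
    refine mem_linearGrowth_of_abs_le g.2 fun x => ?_
    rw [abs_mul, abs_of_nonneg normCutoff_nonneg]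
    exact mul_le_of_le_one_right (abs_nonneg _) normCutoff_le_one
  have hint_cut (n : ℕ) (g : linearGrowth E) (hg : Continuous g.1) :
      ∫ x, g.1 x * normCutoff (n : ℝ) x ∂π = L ⟨_, hcut n g⟩ :=
    RealRMK.integral_rieszMeasure Λ
      ⟨⟨_, hg.mul continuous_normCutoff⟩, hasCompactSupport_mul_normCutoff g.1⟩
  have hintegrable (g : linearGrowth E) (hg : Continuous g.1) : Integrable g.1 π := by
    have habs : (fun x => |g.1 x|) ∈ linearGrowth E :=
      mem_linearGrowth_of_abs_le g.2 fun x => (abs_abs _).le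
    refine (aecover_closedBall (x := (0 : E))
      tendsto_natCast_atTop_atTop).integrable_of_integral_norm_bounded (L ⟨_, habs⟩)
      (fun n => hg.continuousOn.integrableOn_compact (isCompact_closedBall _ _))
      (Filter.Eventually.of_forall fun n => ?_)
    calc ∫ x in Metric.closedBall 0 (n : ℝ), ‖g.1 x‖ ∂π
        = ∫ x in Metric.closedBall 0 (n : ℝ), |g.1 x| * normCutoff (n : ℝ) x ∂π := by
          refine setIntegral_congr_fun Metric.isClosed_closedBall.measurableSet fun x hx => ?_
          simp [normCutoff_eq_one (mem_closedBall_zero_iff.1 hx)]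
      _ ≤ ∫ x, |g.1 x| * normCutoff (n : ℝ) x ∂π := by
          refine setIntegral_le_integral ?_ (Filter.Eventually.of_forall fun x =>
            mul_nonneg (abs_nonneg _) normCutoff_nonneg)
          exact (hg.abs.mul continuous_normCutoff).integrable_of_hasCompactSupport
            (hasCompactSupport_mul_normCutoff _)
      _ = L ⟨_, hcut n ⟨_, habs⟩⟩ := hint_cut n ⟨_, habs⟩ hg.abs
      _ ≤ L ⟨_, habs⟩ := hmono _ _ fun x =>
          mul_le_of_le_one_right (abs_nonneg _) normCutoff_le_one
  refine ⟨π, fun g hg => ⟨hintegrable g hg, ?_⟩⟩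
  obtain ⟨C, hC⟩ := g.2
  have hlim : Filter.Tendsto (fun n : ℕ => ∫ x, g.1 x * normCutoff (n : ℝ) x ∂π)
      Filter.atTop (nhds (∫ x, g.1 x ∂π)) := by
    refine tendsto_integral_of_dominated_convergence (fun x => |g.1 x|)
      (fun n => (hg.mul continuous_normCutoff).aestronglyMeasurable)
      (hintegrable g hg).abs (fun n => Filter.Eventually.of_forall fun x => ?_)
      (Filter.Eventually.of_forall fun x => ?_)
    · rw [Real.norm_eq_abs, abs_mul, abs_of_nonneg normCutoff_nonneg]
      exact mul_le_of_le_one_right (abs_nonneg _) normCutoff_le_one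
    · refine tendsto_const_nhds.congr' ?_
      filter_upwards [Filter.eventually_ge_atTop ⌈‖x‖⌉₊] with n hn
      rw [normCutoff_eq_one (Nat.ceil_le.1 hn), mul_one]
  have hC0 : 0 ≤ C := by simpa using (abs_nonneg _).trans (hC 0)
  have hbound (n : ℕ) (f : linearGrowth E) (hf : ∀ x, |f.1 x| ≤ C * (1 + ‖x‖)) :
      L (f - ⟨_, hcut n f⟩) ≤ (C + 1) * ε n := by
    have hscaled := htight n ((C + 1)⁻¹ • (f - ⟨_, hcut n f⟩)) fun x => ?_
    · rw [map_smul, smul_eq_mul, inv_mul_le_iff₀ (by linarith)] at hscaled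
      exact hscaled
    · change (C + 1)⁻¹ * (f.1 x - f.1 x * normCutoff (n : ℝ) x) ≤ _
      split_ifs with hx
      · simp [normCutoff_eq_one hx]
      · rw [inv_mul_le_iff₀ (by linarith)]
        have h1 := (abs_le.1 (hf x)).1
        have h2 := (abs_le.1 (hf x)).2
        have h3 := normCutoff_nonneg (r := (n : ℝ)) (x := x)
        have h4 := normCutoff_le_one (r := (n : ℝ)) (x := x)
        nlinarith [norm_nonneg x, mul_nonneg hC0 (norm_nonneg x)]
  refine tendsto_nhds_unique hlim ?_
  rw [tendsto_iff_norm_sub_tendsto_zero]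
  have hz : Filter.Tendsto (fun n => (C + 1) * ε n) Filter.atTop (nhds 0) := by
    simpa using hε.const_mul (C + 1)
  refine squeeze_zero (fun _ => norm_nonneg _) (fun n => ?_) hz
  rw [hint_cut n g hg, ← map_sub, Real.norm_eq_abs, abs_le', ← map_neg, neg_sub]
  refine ⟨?_, hbound n g hC⟩
  have hneg := hbound n (-g) fun x => by simpa using hC x
  refine (congrArg L (Subtype.ext (funext fun x => ?_))).trans_le hneg
  change g.1 x * _ - g.1 x = -g.1 x - -g.1 x * _
  ring

/-- If `f (X a) * w a` has integral zero for all bounded continuous `f`, then it does so for all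
bounded measurable `f`. -/
lemma integral_comp_mul_eq_zero_of_forall_continuous {α E : Type*} [MeasurableSpace α]
    [TopologicalSpace E] [MeasurableSpace E] [BorelSpace E] [HasOuterApproxClosed E]
    {π : Measure α} {X : α → E} (hX : Measurable X) {w : α → ℝ} (hw : Integrable w π)
    (h : ∀ f : BoundedContinuousFunction E ℝ, ∫ a, f (X a) * w a ∂π = 0)
    {f : E → ℝ} (hf : Measurable f) (hb : ∃ C, ∀ x, |f x| ≤ C) :
    ∫ a, f (X a) * w a ∂π = 0 := by
  let ν (v : α → ℝ) : Measure E := (π.withDensity fun a => ENNReal.ofReal (v a)).map X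
  have hν {v : α → ℝ} (hv : Integrable v π) : IsFiniteMeasure (ν v) := by
    have := isFiniteMeasure_withDensity_ofReal hv.2
    exact Measure.isFiniteMeasure_map _ _
  have hint {v : α → ℝ} (hv : Integrable v π) {g : E → ℝ} (hg : Measurable g) :
      ∫ x, g x ∂ν v = ∫ a, g (X a) * max (v a) 0 ∂π := by
    rw [integral_map hX.aemeasurable hg.aestronglyMeasurable,
      integral_withDensity_eq_integral_toReal_smul₀ hv.aemeasurable.ennreal_ofReal
        (Filter.Eventually.of_forall fun _ => ENNReal.ofReal_lt_top)]
    exact integral_congr_ae (Filter.Eventually.of_forall fun a => mul_comm _ _)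
  have hsplit {g : E → ℝ} (hg : Measurable g) (hgb : ∃ C, ∀ x, |g x| ≤ C) :
      ∫ a, g (X a) * w a ∂π = ∫ x, g x ∂ν w - ∫ x, g x ∂ν (-w) := by
    obtain ⟨C, hC⟩ := hgb
    rw [hint hw hg, hint hw.neg hg, ← integral_sub]
    · refine integral_congr_ae (Filter.Eventually.of_forall fun a => ?_)
      simp only [Pi.neg_apply, ← mul_sub]
      rw [max_zero_sub_eq_self]
    · exact hw.pos_part.bdd_mul (hg.comp hX).aestronglyMeasurable
        (Filter.Eventually.of_forall fun a => hC (X a))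
    · exact hw.neg.pos_part.bdd_mul (hg.comp hX).aestronglyMeasurable
        (Filter.Eventually.of_forall fun a => hC (X a))
  have := hν hw
  have := hν hw.neg
  have hext : ν w = ν (-w) := ext_of_forall_integral_eq_of_IsFiniteMeasure fun g => by
    rw [← sub_eq_zero, ← hsplit g.continuous.measurable ⟨‖g‖, g.norm_coe_le_norm⟩, h]
  rw [hsplit hf hb, hext, sub_self]

/-- Superhedging duality: under the convex order, the price of the semi-static positions extends
to a positive functional on all functions of linear growth. -/
lemma exists_positive_functional_of_convexOrder {ι : Type*} [Fintype ι]
    {ρ μ : Measure (ι → ℝ)} [IsFiniteMeasure ρ] [IsFiniteMeasure μ]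
    (hρ : Integrable (fun x => ‖x‖) ρ) (hμ : Integrable (fun x => ‖x‖) μ)
    (h : ∀ φ : (ι → ℝ) → ℝ, ConvexOn ℝ Set.univ φ → Integrable φ μ →
      Integrable φ ρ ∧ ∫ x, φ x ∂ρ ≤ ∫ x, φ x ∂μ) :
    ∃ L : linearGrowth ((ι → ℝ) × (ι → ℝ)) →ₗ[ℝ] ℝ,
      (∀ g : linearGrowth ((ι → ℝ) × (ι → ℝ)), (∀ p, 0 ≤ g.1 p) → 0 ≤ L g) ∧
      ∀ (g : linearGrowth ((ι → ℝ) × (ι → ℝ))) (ψ φ : (ι → ℝ) → ℝ) (b : ι → (ι → ℝ) → ℝ),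
        Integrable ψ ρ → Integrable φ μ →
        (∀ p, g.1 p = ψ p.1 + φ p.2 + ∑ i, b i p.1 * (p.2 i - p.1 i)) →
        L g = ∫ x, ψ x ∂ρ + ∫ y, φ y ∂μ := by
  let V := linearGrowth ((ι → ℝ) × (ι → ℝ))
  let R : Submodule ℝ (V × ℝ) :=
    { carrier := {q | ∃ (ψ φ : (ι → ℝ) → ℝ) (b : ι → (ι → ℝ) → ℝ),
        Integrable ψ ρ ∧ Integrable φ μ ∧
        (∀ p, q.1.1 p = ψ p.1 + φ p.2 + ∑ i, b i p.1 * (p.2 i - p.1 i)) ∧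
        q.2 = ∫ x, ψ x ∂ρ + ∫ y, φ y ∂μ}
      zero_mem' := ⟨0, 0, 0, integrable_zero _ _ _, integrable_zero _ _ _,
        fun p => by simp, by simp⟩
      add_mem' := by
        rintro q q' ⟨ψ, φ, b, hψ, hφ, hq, hq2⟩ ⟨ψ', φ', b', hψ', hφ', hq', hq2'⟩
        refine ⟨ψ + ψ', φ + φ', b + b', hψ.add hψ', hφ.add hφ', fun p => ?_, ?_⟩
        · change q.1.1 p + q'.1.1 p = _
          simp only [hq, hq', Pi.add_apply, add_mul, Finset.sum_add_distrib]
          ring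
        · simp only [Prod.snd_add, hq2, hq2', integral_add' hψ hψ', integral_add' hφ hφ']
          ring
      smul_mem' := by
        rintro a q ⟨ψ, φ, b, hψ, hφ, hq, hq2⟩
        refine ⟨a • ψ, a • φ, a • b, hψ.smul a, hφ.smul a, fun p => ?_, ?_⟩
        · change a * q.1.1 p = _
          simp only [hq, Pi.smul_apply, smul_eq_mul, mul_add, Finset.mul_sum, mul_assoc]
        · simp only [Prod.smul_snd, hq2, Pi.smul_apply, smul_eq_mul, integral_const_mul, mul_add] }
  have hR_nonneg (q : V × ℝ) (hq : q ∈ R) (hpos : ∀ p, 0 ≤ q.1.1 p) : 0 ≤ q.2 := by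
    obtain ⟨ψ, φ, b, hψ, hφ, hq1, hq2⟩ := hq
    rw [hq2]
    exact integral_add_integral_nonneg_of_convexOrder hμ h b hψ hφ fun x y => by
      rw [← hq1 (x, y)]
      exact hpos _
  have hR_graph (q : V × ℝ) (hq : q ∈ R) (hq0 : q.1 = 0) : q.2 = 0 := by
    refine le_antisymm ?_ (hR_nonneg q hq fun p => by simp [hq0])
    simpa using hR_nonneg (-q) (R.neg_mem hq) fun p => by simp [hq0]
  let S : PointedCone ℝ V :=
    { carrier := {g | ∀ p, 0 ≤ g.1 p}
      zero_mem' := fun p => le_rfl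
      add_mem' := fun hf hg p => add_nonneg (hf p) (hg p)
      smul_mem' := fun a g hg p => mul_nonneg a.2 (hg p) }
  have hgrowth {ν : Measure (ι → ℝ)} [IsFiniteMeasure ν] (hν : Integrable (fun x => ‖x‖) ν)
      (C : ℝ) : Integrable (fun x => C * (1 + ‖x‖)) ν :=
    ((integrable_const 1).add hν).const_mul C
  obtain ⟨L, hL, hLpos⟩ := riesz_extension S R.toLinearPMap
    (fun x hx => hR_nonneg _ (R.mem_graph_toLinearPMap hR_graph x) hx) fun g => by
      obtain ⟨C, hC⟩ := g.2
      have hC0 : 0 ≤ C := by simpa using (abs_nonneg _).trans (hC 0)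
      have hmem : (fun p : (ι → ℝ) × (ι → ℝ) => C * (1 + ‖p.1‖) + C * (1 + ‖p.2‖)) ∈ V := by
        refine ⟨2 * C, fun p => ?_⟩
        rw [abs_of_nonneg (by positivity)]
        nlinarith [norm_fst_le p, norm_snd_le p]
      have hR : ((⟨_, hmem⟩ : V), ∫ x, C * (1 + ‖x‖) ∂ρ + ∫ y, C * (1 + ‖y‖) ∂μ) ∈ R :=
        ⟨_, _, 0, hgrowth hρ C, hgrowth hμ C, fun p => by simp, rfl⟩
      refine ⟨⟨_, Submodule.mem_map_of_mem hR⟩, fun p => ?_⟩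
      change 0 ≤ C * (1 + ‖p.1‖) + C * (1 + ‖p.2‖) + g.1 p
      have h1 := (abs_le.1 (hC p)).1
      have h2 : ‖p‖ ≤ ‖p.1‖ + ‖p.2‖ :=
        max_le (le_add_of_nonneg_right (norm_nonneg _)) (le_add_of_nonneg_left (norm_nonneg _))
      nlinarith
  refine ⟨L, fun g hg => hLpos g hg, fun g ψ φ b hψ hφ hg => ?_⟩
  have hR : (g, ∫ x, ψ x ∂ρ + ∫ y, φ y ∂μ) ∈ R := ⟨ψ, φ, b, hψ, hφ, hg, rfl⟩
  have hdom : g ∈ R.toLinearPMap.domain := Submodule.mem_map_of_mem hR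
  rw [hL ⟨g, hdom⟩, ← sub_eq_zero]
  refine hR_graph (g - g, _ - _) ?_ (sub_self g)
  exact R.sub_mem (R.mem_graph_toLinearPMap hR_graph ⟨g, hdom⟩) hR

/-- The integral of `1 + ‖x‖` outside of large balls tends to zero. -/
lemma tendsto_integral_norm_tail {E : Type*} [NormedAddCommGroup E] [MeasurableSpace E]
    [OpensMeasurableSpace E] {ν : Measure E} [IsFiniteMeasure ν]
    (hν : Integrable (fun x => ‖x‖) ν) :
    (∀ n : ℕ, Integrable (fun x : E => if ‖x‖ ≤ n then 0 else 1 + ‖x‖) ν) ∧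
    Filter.Tendsto (fun n : ℕ => ∫ x : E, (if ‖x‖ ≤ n then 0 else 1 + ‖x‖) ∂ν)
      Filter.atTop (nhds 0) := by
  have hmeas (n : ℕ) : Measurable fun x : E => if ‖x‖ ≤ n then 0 else 1 + ‖x‖ :=
    Measurable.ite (measurableSet_le measurable_norm measurable_const) measurable_const
      (measurable_norm.const_add 1)
  have hle (n : ℕ) (x : E) : ‖if ‖x‖ ≤ n then 0 else 1 + ‖x‖‖ ≤ 1 + ‖x‖ := by
    split_ifs
    · rw [norm_zero]; positivity
    · rw [Real.norm_of_nonneg (by positivity)]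
  have hint : Integrable (fun x : E => 1 + ‖x‖) ν := (integrable_const 1).add hν
  refine ⟨fun n => hint.mono' (hmeas n).aestronglyMeasurable
    (Filter.Eventually.of_forall (hle n)), ?_⟩
  suffices hlim : Filter.Tendsto (fun n : ℕ => ∫ x : E, (if ‖x‖ ≤ n then 0 else 1 + ‖x‖) ∂ν)
      Filter.atTop (nhds (∫ _ : E, (0 : ℝ) ∂ν)) by simpa only [integral_zero] using hlim
  refine tendsto_integral_of_dominated_convergence _
    (fun n => (hmeas n).aestronglyMeasurable) hint
    (fun n => Filter.Eventually.of_forall (hle n)) (Filter.Eventually.of_forall fun x => ?_)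
  refine tendsto_const_nhds.congr' ?_
  filter_upwards [Filter.eventually_ge_atTop ⌈‖x‖⌉₊] with n hn
  rw [if_pos (Nat.ceil_le.1 hn)]

/-- Probability measures in convex order admit a martingale coupling. -/
lemma exists_martingale_coupling_of_convexOrder {ι : Type*} [Fintype ι]
    {ρ μ : Measure (ι → ℝ)} [IsProbabilityMeasure ρ] [IsProbabilityMeasure μ]
    (hρ : Integrable (fun x => ‖x‖) ρ) (hμ : Integrable (fun x => ‖x‖) μ)
    (h : ∀ φ : (ι → ℝ) → ℝ, ConvexOn ℝ Set.univ φ → Integrable φ μ →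
      Integrable φ ρ ∧ ∫ x, φ x ∂ρ ≤ ∫ x, φ x ∂μ) :
    ∃ π : Measure ((ι → ℝ) × (ι → ℝ)), IsProbabilityMeasure π ∧
      π.map Prod.fst = ρ ∧ π.map Prod.snd = μ ∧
      ∀ f : (ι → ℝ) → ℝ, Measurable f → (∃ C : ℝ, ∀ x, |f x| ≤ C) →
        ∀ i, ∫ p, f p.1 * (p.2 i - p.1 i) ∂π = 0 := by
  classical
  obtain ⟨L, hLpos, hL⟩ := exists_positive_functional_of_convexOrder hρ hμ h
  obtain ⟨hρint, hρlim⟩ := tendsto_integral_norm_tail hρ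
  obtain ⟨hμint, hμlim⟩ := tendsto_integral_norm_tail hμ
  obtain ⟨π, hπ⟩ := exists_measure_of_positive_of_tight L hLpos
    (by simpa using hρlim.add hμlim) fun n g hg => by
      have hmem : (fun p : (ι → ℝ) × (ι → ℝ) => (if ‖p.1‖ ≤ n then 0 else 1 + ‖p.1‖) +
          (if ‖p.2‖ ≤ n then 0 else 1 + ‖p.2‖)) ∈ linearGrowth ((ι → ℝ) × (ι → ℝ)) := by
        refine ⟨2, fun p => ?_⟩
        have h1 := norm_fst_le p
        have h2 := norm_snd_le p
        have h3 := norm_nonneg p.1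
        have h4 := norm_nonneg p.2
        dsimp only
        rw [abs_of_nonneg (by split_ifs <;> linarith)]
        split_ifs <;> linarith
      rw [← hL ⟨_, hmem⟩ _ _ 0 (hρint n) (hμint n) fun p => by simp, ← sub_nonneg, ← map_sub]
      refine hLpos _ fun p => sub_nonneg.2 ((hg p).trans ?_)
      have h3 := norm_nonneg p.1
      have h4 := norm_nonneg p.2
      change (if ‖p‖ ≤ n then 0 else 1 + ‖p‖) ≤
        (if ‖p.1‖ ≤ n then 0 else 1 + ‖p.1‖) + (if ‖p.2‖ ≤ n then 0 else 1 + ‖p.2‖)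
      rw [Prod.norm_def]
      rcases max_cases ‖p.1‖ ‖p.2‖ with ⟨h5, h6⟩ | ⟨h5, h6⟩ <;> rw [h5] <;>
        split_ifs <;> linarith
  have hfst (f : BoundedContinuousFunction (ι → ℝ) ℝ) :
      Integrable (fun p => f p.1) π ∧ ∫ p, f p.1 ∂π = ∫ x, f x ∂ρ := by
    obtain ⟨h1, h2⟩ := hπ ⟨fun p => f p.1, mem_linearGrowth_of_bounded fun p =>
      f.norm_coe_le_norm p.1⟩ (f.continuous.comp continuous_fst)
    refine ⟨h1, h2.trans ?_⟩
    rw [hL _ f 0 0 (f.integrable ρ) (integrable_zero _ _ _) fun p => by simp]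
    simp
  have hsnd (f : BoundedContinuousFunction (ι → ℝ) ℝ) :
      ∫ p, f p.2 ∂π = ∫ x, f x ∂μ := by
    obtain ⟨-, h2⟩ := hπ ⟨fun p => f p.2, mem_linearGrowth_of_bounded fun p =>
      f.norm_coe_le_norm p.2⟩ (f.continuous.comp continuous_snd)
    refine h2.trans ?_
    rw [hL _ 0 f 0 (integrable_zero _ _ _) (f.integrable μ) fun p => by simp]
    simp
  have hfin : IsFiniteMeasure π := by
    have := (hfst (BoundedContinuousFunction.const _ 1)).1
    simpa [integrable_const_iff] using this
  have hmap_fst : π.map Prod.fst = ρ := ext_of_forall_integral_eq_of_IsFiniteMeasure fun f => by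
    rw [integral_map measurable_fst.aemeasurable f.continuous.aestronglyMeasurable, (hfst f).2]
  have hmap_snd : π.map Prod.snd = μ := ext_of_forall_integral_eq_of_IsFiniteMeasure fun f => by
    rw [integral_map measurable_snd.aemeasurable f.continuous.aestronglyMeasurable, hsnd f]
  refine ⟨π, ⟨?_⟩, hmap_fst, hmap_snd, fun f hf hb i => ?_⟩
  · rw [← Set.preimage_univ (f := Prod.fst), ← Measure.map_apply measurable_fst .univ, hmap_fst,
      measure_univ]
  have hcoord (p : (ι → ℝ) × (ι → ℝ)) : |p.2 i - p.1 i| ≤ 2 * ‖p‖ := by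
    have h1 := (norm_le_pi_norm p.1 i).trans (norm_fst_le p)
    have h2 := (norm_le_pi_norm p.2 i).trans (norm_snd_le p)
    exact (abs_sub _ _).trans (by rw [Real.norm_eq_abs] at h1 h2; linarith)
  have hgrowth (f : BoundedContinuousFunction (ι → ℝ) ℝ) :
      (fun p : (ι → ℝ) × (ι → ℝ) => f p.1 * (p.2 i - p.1 i)) ∈
        linearGrowth ((ι → ℝ) × (ι → ℝ)) := by
    refine ⟨‖f‖ * 2, fun p => ?_⟩
    rw [abs_mul, mul_assoc]
    refine mul_le_mul (f.norm_coe_le_norm p.1) ((hcoord p).trans ?_) (abs_nonneg _)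
      (norm_nonneg f)
    linarith
  have hcont (f : BoundedContinuousFunction (ι → ℝ) ℝ) :
      Continuous fun p : (ι → ℝ) × (ι → ℝ) => f p.1 * (p.2 i - p.1 i) := by fun_prop
  refine integral_comp_mul_eq_zero_of_forall_continuous measurable_fst ?_ (fun g => ?_) hf hb
  · simpa using (hπ ⟨_, hgrowth (BoundedContinuousFunction.const _ 1)⟩ (hcont _)).1
  · refine (hπ ⟨_, hgrowth g⟩ (hcont g)).2.trans ?_
    rw [hL _ 0 0 (Pi.single i g) (integrable_zero _ _ _) (integrable_zero _ _ _) fun p => ?_]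
    · simp
    · rw [Finset.sum_eq_single i (fun j _ hj => by simp [hj]) (by simp)]
      simp

/-- **Strassen's theorem.** For Borel probability measures `ρ, μ` on `ℝ^d` with
finite first moment, `ρ ≼_C μ` in convex order iff there exists a martingale
coupling of `ρ` and `μ`. -/
theorem strassen_convex_order_iff_martingale_coupling (d : ℕ)
    (ρ μ : Measure (Fin d → ℝ))
    [IsProbabilityMeasure ρ] [IsProbabilityMeasure μ]
    (hρ : Integrable (fun x => ‖x‖) ρ) (hμ : Integrable (fun x => ‖x‖) μ) :
    (∀ φ : (Fin d → ℝ) → ℝ, ConvexOn ℝ Set.univ φ → Integrable φ μ →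
      Integrable φ ρ ∧ ∫ x, φ x ∂ρ ≤ ∫ x, φ x ∂μ) ↔
    (∃ π : Measure ((Fin d → ℝ) × (Fin d → ℝ)), IsProbabilityMeasure π ∧
      π.map Prod.fst = ρ ∧ π.map Prod.snd = μ ∧
      ∀ f : (Fin d → ℝ) → ℝ, Measurable f → (∃ C : ℝ, ∀ x, |f x| ≤ C) →
        ∀ i : Fin d, ∫ p : (Fin d → ℝ) × (Fin d → ℝ),
          f p.1 * (p.2 i - p.1 i) ∂π = 0) := by
  refine ⟨exists_martingale_coupling_of_convexOrder hρ hμ, ?_⟩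
  rintro ⟨π, hπ, rfl, rfl, hm⟩ φ hφ hint
  have hcont : Continuous φ := continuousOn_univ.1 (hφ.continuousOn isOpen_univ)
  have h1 : Integrable Prod.fst π :=
    ((integrable_norm_iff measurable_id.aestronglyMeasurable).1 hρ).comp_measurable measurable_fst
  have h2 : Integrable Prod.snd π :=
    ((integrable_norm_iff measurable_id.aestronglyMeasurable).1 hμ).comp_measurable measurable_snd
  rw [integrable_map_measure hcont.aestronglyMeasurable measurable_fst.aemeasurable,
    integral_map measurable_fst.aemeasurable hcont.aestronglyMeasurable,
    integral_map measurable_snd.aemeasurable hcont.aestronglyMeasurable]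
  exact integral_le_of_martingale h1 h2 hm hφ (hint.comp_measurable measurable_snd)
end

section
/- Let x ∈ ℝ^n be an irreducible score (in particular with nondecreasing coordinates), and let M = (m_{ij}) be the unique minimizer of H(M) = ∑_{i,j} m_{ij} log m_{ij} on Θ_n(x). Then the rows of M, viewed as probability measures μ_i = ∑_j m_{ij} δ_{j−1}, are nondecreasing in stochastic order: for all i ≤ i′ and all 1 ≤ k ≤ n, ∑_{j=1}^k m_{ij} ≥ ∑_{j=1}^k m_{i′j}. Consequently the generalized tournament matrix p_{ij} = ∑_{a>b} m_{ia} m_{jb} + (1/2) ∑_a m_{ia} m_{ja} satisfies strong stochastic transitivity. -/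
open Finset

/-- `Θ_n(x)`: doubly stochastic matrices whose rows, viewed as measures
`μ_i = ∑_j m_{ij} δ_{j-1}`, have barycenter `x_i`. -/
def Theta (n : ℕ) (x : Fin n → ℝ) : Set (Fin n → Fin n → ℝ) :=
  {M | (∀ i j, 0 ≤ M i j) ∧ (∀ i, ∑ j, M i j = 1) ∧ (∀ j, ∑ i, M i j = 1) ∧
    (∀ i, ∑ j : Fin n, ((j : ℕ) : ℝ) * M i j = x i)}

/-- The entropy `H(M) = ∑_{i,j} m_{ij} log m_{ij}` (note `Real.log 0 = 0`). -/
noncomputable def entropyH (n : ℕ) (M : Fin n → Fin n → ℝ) : ℝ :=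
  ∑ i, ∑ j, M i j * Real.log (M i j)

/-- Moving two nonnegative numbers closer together, keeping their sum, strictly decreases
the sum of the values of `t ↦ t log t`. -/
theorem mul_log_transfer_lt {p q δ : ℝ} (hq : 0 ≤ q) (hδ : 0 < δ) (hpq : δ < p - q) :
    (p - δ) * Real.log (p - δ) + (q + δ) * Real.log (q + δ) <
      p * Real.log p + q * Real.log q := by
  have hd : 0 < p - q := hδ.trans hpq
  have hc := Real.strictConvexOn_mul_log.2
  have hp : p ∈ Set.Ici (0 : ℝ) := by simp only [Set.mem_Ici]; linarith
  have hqm : q ∈ Set.Ici (0 : ℝ) := hq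
  have hne : p ≠ q := by intro h; simp [h] at hd
  have ht0 : 0 < δ / (p - q) := div_pos hδ hd
  have ht1 : 0 < 1 - δ / (p - q) := by rw [sub_pos, div_lt_one hd]; exact hpq
  have h1 := hc hp hqm hne ht1 ht0 (by ring)
  have h2 := hc hp hqm hne ht0 ht1 (by ring)
  simp only [smul_eq_mul] at h1 h2
  have e : δ / (p - q) * (p - q) = δ := div_mul_cancel₀ _ hd.ne'
  have e1 : (1 - δ / (p - q)) * p + δ / (p - q) * q = p - δ := by linear_combination -e
  have e2 : δ / (p - q) * p + (1 - δ / (p - q)) * q = q + δ := by linear_combination e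
  rw [e1] at h1
  rw [e2] at h2
  linarith

/-- The matrix obtained by adding `v` to row `i` and subtracting it from row `i'`. -/
def rowTransfer {n : ℕ} (M : Fin n → Fin n → ℝ) (i i' : Fin n) (v : Fin n → ℝ) :
    Fin n → Fin n → ℝ :=
  fun r j => M r j + ((if r = i then 1 else 0) - (if r = i' then 1 else 0)) * v j

theorem rowTransfer_left {n : ℕ} (M : Fin n → Fin n → ℝ) {i i' : Fin n} (h : i ≠ i')
    (v : Fin n → ℝ) (j : Fin n) : rowTransfer M i i' v i j = M i j + v j := by
  simp [rowTransfer, h]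

theorem rowTransfer_right {n : ℕ} (M : Fin n → Fin n → ℝ) {i i' : Fin n} (h : i ≠ i')
    (v : Fin n → ℝ) (j : Fin n) : rowTransfer M i i' v i' j = M i' j - v j := by
  simp [rowTransfer, h.symm, sub_eq_add_neg]

theorem rowTransfer_of_ne {n : ℕ} (M : Fin n → Fin n → ℝ) {i i' r : Fin n} (h : r ≠ i)
    (h' : r ≠ i') (v : Fin n → ℝ) (j : Fin n) : rowTransfer M i i' v r j = M r j := by
  simp [rowTransfer, h, h']

theorem rowTransfer_mem_Theta {n : ℕ} {x : Fin n → ℝ} {M : Fin n → Fin n → ℝ}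
    (hM : M ∈ Theta n x) {i i' : Fin n} (h : i ≠ i') {v : Fin n → ℝ}
    (hv : ∑ j, v j = 0) (hv' : ∑ j : Fin n, ((j : ℕ) : ℝ) * v j = 0)
    (hi : ∀ j, 0 ≤ M i j + v j) (hi' : ∀ j, 0 ≤ M i' j - v j) :
    rowTransfer M i i' v ∈ Theta n x := by
  obtain ⟨h0, h1, h2, h3⟩ := hM
  refine ⟨fun r j => ?_, fun r => ?_, fun j => ?_, fun r => ?_⟩
  · by_cases hr : r = i
    · subst hr; rw [rowTransfer_left M h]; exact hi j
    by_cases hr' : r = i'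
    · subst hr'; rw [rowTransfer_right M h]; exact hi' j
    rw [rowTransfer_of_ne M hr hr']; exact h0 r j
  · simp only [rowTransfer, sum_add_distrib, ← mul_sum, hv, h1, mul_zero, add_zero]
  · simp only [rowTransfer, sum_add_distrib, ← sum_mul, sum_sub_distrib, h2]
    simp
  · have : ∀ j : Fin n, ((j : ℕ) : ℝ) * rowTransfer M i i' v r j =
        ((j : ℕ) : ℝ) * M r j + ((if r = i then 1 else 0) - (if r = i' then 1 else 0)) *
          (((j : ℕ) : ℝ) * v j) := fun j => by simp only [rowTransfer]; ring
    simp only [this, sum_add_distrib, ← mul_sum, hv', h3, mul_zero, add_zero]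

theorem entropyH_rowTransfer_sub {n : ℕ} (M : Fin n → Fin n → ℝ) {i i' : Fin n} (h : i ≠ i')
    (v : Fin n → ℝ) :
    entropyH n (rowTransfer M i i' v) - entropyH n M =
      ∑ j, (((M i j + v j) * Real.log (M i j + v j) +
          (M i' j - v j) * Real.log (M i' j - v j)) -
        (M i j * Real.log (M i j) + M i' j * Real.log (M i' j))) := by
  unfold entropyH
  rw [← sum_sub_distrib, Fintype.sum_eq_add i i' h]
  · rw [← sum_sub_distrib, ← sum_sub_distrib, ← sum_add_distrib]
    refine sum_congr rfl fun j _ => ?_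
    rw [rowTransfer_left M h, rowTransfer_right M h]
    ring
  · rintro r ⟨hr, hr'⟩
    simp only [rowTransfer_of_ne M hr hr', sub_self]

/-- The difference of two rows of an entropy minimizer does not have the
sign pattern `+, -, +` along three increasing columns. -/
theorem entropy_minimizer_no_alternation {n : ℕ} {x : Fin n → ℝ} {M : Fin n → Fin n → ℝ}
    (hM : M ∈ Theta n x) (hmin : ∀ N ∈ Theta n x, entropyH n M ≤ entropyH n N)
    {i i' a b c : Fin n} (hab : a < b) (hbc : b < c) (ha : M i' a < M i a)
    (hb : M i b < M i' b) (hc : M i' c < M i c) : False := by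
  have hii : i ≠ i' := by rintro rfl; exact lt_irrefl _ ha
  have hab' : ((a : ℕ) : ℝ) < (b : ℕ) := by exact_mod_cast hab
  have hbc' : ((b : ℕ) : ℝ) < (c : ℕ) := by exact_mod_cast hbc
  have hba := hab.ne'
  have hcb := hbc.ne'
  have hca := (hab.trans hbc).ne'
  obtain ⟨ε, hε, hεa, hεb, hεc⟩ : ∃ ε : ℝ, 0 < ε ∧
      ε * (((c : ℕ) : ℝ) - (b : ℕ)) < M i a - M i' a ∧
      ε * (((c : ℕ) : ℝ) - (a : ℕ)) < M i' b - M i b ∧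
      ε * (((b : ℕ) : ℝ) - (a : ℕ)) < M i c - M i' c := by
    have key : ∀ s t : ℝ, 0 < t → ∀ᶠ ε in nhdsWithin (0 : ℝ) (Set.Ioi 0), ε * s < t := by
      intro s t ht
      have : Filter.Tendsto (fun ε : ℝ => ε * s) (nhdsWithin 0 (Set.Ioi 0)) (nhds (0 * s)) :=
        (Continuous.tendsto (by fun_prop) 0).mono_left nhdsWithin_le_nhds
      rw [zero_mul] at this
      exact this.eventually_lt_const ht
    obtain ⟨ε, h⟩ := ((Filter.eventually_mem_set.2 self_mem_nhdsWithin).and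
      ((key _ _ (sub_pos.2 ha)).and ((key _ _ (sub_pos.2 hb)).and
        (key _ _ (sub_pos.2 hc))))).exists
    exact ⟨ε, h.1, h.2.1, h.2.2.1, h.2.2.2⟩
  have hδa : 0 < ε * (((c : ℕ) : ℝ) - (b : ℕ)) := mul_pos hε (sub_pos.2 hbc')
  have hδb : 0 < ε * (((c : ℕ) : ℝ) - (a : ℕ)) := mul_pos hε (sub_pos.2 (hab'.trans hbc'))
  have hδc : 0 < ε * (((b : ℕ) : ℝ) - (a : ℕ)) := mul_pos hε (sub_pos.2 hab')
  have h0 := hM.1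
  let v : Fin n → ℝ := fun j =>
    (if j = a then -(ε * (((c : ℕ) : ℝ) - (b : ℕ))) else 0) +
      (if j = b then ε * (((c : ℕ) : ℝ) - (a : ℕ)) else 0) +
      (if j = c then -(ε * (((b : ℕ) : ℝ) - (a : ℕ))) else 0)
  have va : v a = -(ε * (((c : ℕ) : ℝ) - (b : ℕ))) := by simp [v, hba.symm, hca.symm]
  have vb : v b = ε * (((c : ℕ) : ℝ) - (a : ℕ)) := by simp [v, hba, hcb.symm]
  have vc : v c = -(ε * (((b : ℕ) : ℝ) - (a : ℕ))) := by simp [v, hca, hcb]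
  have vo : ∀ j, j ≠ a → j ≠ b → j ≠ c → v j = 0 := fun j h1 h2 h3 => by simp [v, h1, h2, h3]
  have hv : ∑ j, v j = 0 := by
    simp only [v, sum_add_distrib, sum_ite_eq', mem_univ, if_true]; ring
  have hv' : ∑ j : Fin n, ((j : ℕ) : ℝ) * v j = 0 := by
    simp only [v, mul_add, sum_add_distrib, mul_ite, mul_zero, sum_ite_eq', mem_univ, if_true]
    ring
  have cases_col : ∀ P : Fin n → Prop, P a → P b → P c →
      (∀ j, v j = 0 → P j) → ∀ j, P j := by
    intro P pa pb pc po j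
    by_cases h1 : j = a
    · exact h1 ▸ pa
    by_cases h2 : j = b
    · exact h2 ▸ pb
    by_cases h3 : j = c
    · exact h3 ▸ pc
    exact po j (vo j h1 h2 h3)
  have hN : rowTransfer M i i' v ∈ Theta n x := by
    refine rowTransfer_mem_Theta hM hii hv hv' ?_ ?_
    · refine cases_col _ ?_ ?_ ?_ fun j hj => ?_
      · rw [va]; linarith [h0 i' a]
      · rw [vb]; linarith [h0 i b]
      · rw [vc]; linarith [h0 i' c]
      · rw [hj, add_zero]; exact h0 i j
    · refine cases_col _ ?_ ?_ ?_ fun j hj => ?_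
      · rw [va]; linarith [h0 i' a]
      · rw [vb]; linarith [h0 i b]
      · rw [vc]; linarith [h0 i' c]
      · rw [hj, sub_zero]; exact h0 i' j
  have ta := mul_log_transfer_lt (h0 i' a) hδa hεa
  have tb := mul_log_transfer_lt (h0 i b) hδb hεb
  have tc := mul_log_transfer_lt (h0 i' c) hδc hεc
  have hlt : entropyH n (rowTransfer M i i' v) - entropyH n M < 0 := by
    rw [entropyH_rowTransfer_sub M hii]
    refine sum_neg' (cases_col _ (fun _ => ?_) (fun _ => ?_) (fun _ => ?_) fun j hj _ => ?_)
      ⟨a, mem_univ a, ?_⟩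
    · rw [va, sub_neg_eq_add, ← sub_eq_add_neg]; linarith
    · rw [vb]; linarith
    · rw [vc, sub_neg_eq_add, ← sub_eq_add_neg]; linarith
    · simp [hj]
    · rw [va, sub_neg_eq_add, ← sub_eq_add_neg]; linarith
  linarith [hmin _ hN]

/-- A zero-sum vector with nonpositive first moment and without alternating sign
patterns of length three has nonnegative partial sums. -/
theorem partialSum_nonneg_of_no_alternation {n : ℕ} {d : Fin n → ℝ} (hd : ∑ j, d j = 0)
    (hd' : ∑ j : Fin n, ((j : ℕ) : ℝ) * d j ≤ 0)
    (hpos : ∀ a b c, a < b → b < c → 0 < d a → d b < 0 → 0 < d c → False)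
    (hneg : ∀ a b c, a < b → b < c → d a < 0 → 0 < d b → d c < 0 → False) (k : ℕ) :
    0 ≤ ∑ j ∈ univ.filter (fun j : Fin n => (j : ℕ) < k), d j := by
  by_contra! hk
  obtain ⟨a, ha, hda⟩ := exists_lt_of_sum_lt (g := fun _ => (0 : ℝ)) (by simpa using hk)
  have hk' : 0 < ∑ j ∈ univ.filter (fun j : Fin n => ¬ (j : ℕ) < k), d j := by
    have := sum_filter_add_sum_filter_not univ (fun j : Fin n => (j : ℕ) < k) d
    linarith
  obtain ⟨c, hc, hdc⟩ := exists_lt_of_sum_lt (f := fun _ => (0 : ℝ)) (by simpa using hk')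
  simp only [mem_filter, mem_univ, true_and] at ha hc
  have order : ∀ p m, 0 < d p → d m < 0 → m < p := by
    intro p m hp hm
    by_contra! hpm
    have hne : p ≠ m := by rintro rfl; linarith
    have hpm : p < m := lt_of_le_of_ne hpm hne
    by_cases hmk : (m : ℕ) < k
    · exact hpos p m c hpm (by rw [Fin.lt_def]; omega) hp hm hdc
    rcases lt_trichotomy a p with h | h | h
    · exact hneg a p m h hpm hda hp hm
    · subst h; linarith
    · exact hpos p a c h (by rw [Fin.lt_def]; omega) hp hda hdc
  obtain ⟨t, ht, hmax⟩ := exists_max_image (univ.filter fun j => d j < 0) id ⟨a, by simpa using hda⟩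
  simp only [mem_filter, mem_univ, true_and, id] at ht hmax
  have hpos' : 0 < ∑ j : Fin n, (((j : ℕ) : ℝ) - (t : ℕ)) * d j := by
    refine sum_pos' (fun j _ => ?_) ⟨c, mem_univ _, ?_⟩
    · rcases lt_trichotomy (d j) 0 with h | h | h
      · have : ((j : ℕ) : ℝ) ≤ (t : ℕ) := by exact_mod_cast hmax j h
        exact mul_nonneg_of_nonpos_of_nonpos (by linarith) h.le
      · simp [h]
      · have : ((t : ℕ) : ℝ) < (j : ℕ) := by exact_mod_cast order j t h ht
        exact mul_nonneg (by linarith) h.le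
    · have : ((t : ℕ) : ℝ) < (c : ℕ) := by exact_mod_cast order c t hdc ht
      exact mul_pos (by linarith) hdc
  simp only [sub_mul, sum_sub_distrib, ← mul_sum, hd] at hpos'
  linarith

/-- The mass of `f` on the first `k` points. -/
def initialMass {n : ℕ} (f : Fin n → ℝ) (k : ℕ) : ℝ :=
  ∑ j ∈ univ.filter (fun j : Fin n => (j : ℕ) < k), f j

/-- The probability that a score with law `f` beats an independent score with law `g`,
ties being split evenly. -/
noncomputable def winProb {n : ℕ} (f g : Fin n → ℝ) : ℝ :=
  (∑ a : Fin n, ∑ b : Fin n, if (b : ℕ) < (a : ℕ) then f a * g b else 0) +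
    (1 / 2) * ∑ a : Fin n, f a * g a

theorem initialMass_succ {n : ℕ} (f : Fin n → ℝ) (b : Fin n) :
    initialMass f ((b : ℕ) + 1) = initialMass f b + f b := by
  have h : univ.filter (fun j : Fin n => (j : ℕ) < (b : ℕ) + 1) =
      insert b (univ.filter fun j : Fin n => (j : ℕ) < b) := by
    ext j; simp [Fin.ext_iff]; omega
  unfold initialMass
  rw [h, sum_insert (by simp), add_comm]

theorem winProb_eq {n : ℕ} {f : Fin n → ℝ} (hf : ∑ j, f j = 1) (g : Fin n → ℝ) :
    winProb f g = ∑ b : Fin n,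
      g b * (1 - (initialMass f b + initialMass f ((b : ℕ) + 1)) / 2) := by
  unfold winProb
  rw [sum_comm, mul_sum, ← sum_add_distrib]
  refine sum_congr rfl fun b _ => ?_
  have h : ∑ a : Fin n, (if (b : ℕ) < (a : ℕ) then f a else 0) =
      1 - initialMass f ((b : ℕ) + 1) := by
    rw [← hf, ← sum_filter_add_sum_filter_not univ (fun j : Fin n => (j : ℕ) < (b : ℕ) + 1) f,
      ← sum_filter]
    simp [initialMass]
  have h' : ∑ a : Fin n, (if (b : ℕ) < (a : ℕ) then f a * g b else 0) =
      (∑ a : Fin n, (if (b : ℕ) < (a : ℕ) then f a else 0)) * g b := by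
    rw [sum_mul]
    exact sum_congr rfl fun a _ => by rw [ite_mul, zero_mul]
  rw [h', h, initialMass_succ]
  ring

theorem winProb_add_swap {n : ℕ} {f g : Fin n → ℝ} (hf : ∑ j, f j = 1) (hg : ∑ j, g j = 1) :
    winProb f g + winProb g f = 1 := by
  have h : ∑ a : Fin n, ∑ b : Fin n, f a * g b = 1 := by
    simp only [← mul_sum, hg, hf, mul_one]
  have hdiag : ∑ a : Fin n, f a * g a =
      ∑ a : Fin n, ∑ b : Fin n, if a = b then f a * g b else 0 := by simp
  have hcomm : ∑ a : Fin n, g a * f a = ∑ a : Fin n, f a * g a :=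
    sum_congr rfl fun a _ => mul_comm _ _
  have hswap : (∑ a : Fin n, ∑ b : Fin n, if (b : ℕ) < (a : ℕ) then g a * f b else 0) =
      ∑ a : Fin n, ∑ b : Fin n, if (a : ℕ) < (b : ℕ) then f a * g b else 0 := by
    rw [sum_comm]
    simp only [mul_comm]
  have htri : ∑ a : Fin n, ∑ b : Fin n, f a * g b =
      (∑ a : Fin n, ∑ b : Fin n, if (b : ℕ) < (a : ℕ) then f a * g b else 0) +
      (∑ a : Fin n, ∑ b : Fin n, if (a : ℕ) < (b : ℕ) then f a * g b else 0) +
      ∑ a : Fin n, ∑ b : Fin n, if a = b then f a * g b else 0 := by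
    simp only [← sum_add_distrib]
    refine sum_congr rfl fun a _ => sum_congr rfl fun b _ => ?_
    rcases lt_trichotomy (a : ℕ) (b : ℕ) with h | h | h
    · simp [h, h.not_gt, Fin.ext_iff, h.ne]
    · simp [h, Fin.ext_iff]
    · simp [h, h.not_gt, Fin.ext_iff, h.ne']
  unfold winProb
  rw [hswap, hcomm]
  linarith

theorem winProb_le_of_initialMass_le {n : ℕ} {f f' g : Fin n → ℝ} (hf : ∑ j, f j = 1)
    (hf' : ∑ j, f' j = 1) (hg : ∀ j, 0 ≤ g j)
    (h : ∀ k ≤ n, initialMass f' k ≤ initialMass f k) : winProb f g ≤ winProb f' g := by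
  rw [winProb_eq hf, winProb_eq hf']
  refine sum_le_sum fun b _ => mul_le_mul_of_nonneg_left ?_ (hg b)
  linarith [h b b.2.le, h (b + 1) b.2]

/-- If `f` is stochastically smaller than `g` but wins with probability at least one half,
then the two laws agree. -/
theorem eq_of_half_le_winProb {n : ℕ} {f g : Fin n → ℝ} (hf : ∑ j, f j = 1)
    (hg : ∑ j, g j = 1) (hf0 : ∀ j, 0 ≤ f j) (hg0 : ∀ j, 0 ≤ g j)
    (h : ∀ k ≤ n, initialMass g k ≤ initialMass f k) (hp : 1 / 2 ≤ winProb f g) : f = g := by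
  have hgg := winProb_add_swap hg hg
  have hnn : ∀ b ∈ (univ : Finset (Fin n)), 0 ≤ g b * ((initialMass f b - initialMass g b) +
      (initialMass f ((b : ℕ) + 1) - initialMass g ((b : ℕ) + 1))) := fun b _ =>
    mul_nonneg (hg0 b) (by linarith [h b b.2.le, h (b + 1) b.2])
  have hz : ∑ b : Fin n, g b * ((initialMass f b - initialMass g b) +
      (initialMass f ((b : ℕ) + 1) - initialMass g ((b : ℕ) + 1))) =
      2 * (winProb g g - winProb f g) := by
    rw [winProb_eq hf, winProb_eq hg, ← sum_sub_distrib, mul_sum]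
    exact sum_congr rfl fun b _ => by ring
  have hz0 := (sum_eq_zero_iff_of_nonneg hnn).1 (le_antisymm (by linarith) (sum_nonneg hnn))
  have hle : ∀ b ∈ (univ : Finset (Fin n)), g b ≤ f b := by
    intro b hb
    rcases mul_eq_zero.1 (hz0 b hb) with h0 | h0
    · rw [h0]; exact hf0 b
    · have e1 := initialMass_succ f b
      have e2 := initialMass_succ g b
      linarith [h b b.2.le, h (b + 1) b.2]
  exact funext fun b => ((sum_eq_sum_iff_of_le hle).1 (hg.trans hf.symm) b (mem_univ b)).symm

/-- For an irreducible score `x`, the rows of the entropy minimizer on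
`Θ_n(x)` are nondecreasing in stochastic order, and the associated
football-model tournament matrix satisfies strong stochastic transitivity. -/
theorem entropy_minimizer_stochastically_ordered_and_SST (n : ℕ) (x : Fin n → ℝ)
    (hx : Monotone x)
    (hsum : ∑ i, x i = (n * (n - 1) / 2 : ℝ))
    (hirr : ∀ k : ℕ, 1 ≤ k → k < n →
      (k * (k - 1) / 2 : ℝ) <
        ∑ i ∈ Finset.univ.filter (fun i : Fin n => (i : ℕ) < k), x i)
    (M : Fin n → Fin n → ℝ) (hM : M ∈ Theta n x)
    (hmin : ∀ N ∈ Theta n x, entropyH n M ≤ entropyH n N)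
    (p : Fin n → Fin n → ℝ)
    (hp : ∀ i j, p i j =
      (∑ a : Fin n, ∑ b : Fin n, if (b : ℕ) < (a : ℕ) then M i a * M j b else 0) +
        (1 / 2) * ∑ a : Fin n, M i a * M j a) :
    (∀ i i' : Fin n, i ≤ i' → ∀ k : ℕ, k ≤ n →
      ∑ j ∈ Finset.univ.filter (fun j : Fin n => (j : ℕ) < k), M i' j ≤
        ∑ j ∈ Finset.univ.filter (fun j : Fin n => (j : ℕ) < k), M i j) ∧
    (∀ i j k : Fin n, 1 / 2 ≤ p i j → 1 / 2 ≤ p j k →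
      max (p i j) (p j k) ≤ p i k) := by
  have h0 := hM.1
  have h1 := hM.2.1
  have h3 := hM.2.2.2
  have hord : ∀ i i' : Fin n, i ≤ i' → ∀ k : ℕ, k ≤ n →
      initialMass (M i') k ≤ initialMass (M i) k := by
    intro i i' hii k _
    have hs : ∑ j, (M i j - M i' j) = 0 := by rw [sum_sub_distrib, h1, h1, sub_self]
    have hs' : ∑ j : Fin n, ((j : ℕ) : ℝ) * (M i j - M i' j) ≤ 0 := by
      simp only [mul_sub, sum_sub_distrib, h3]
      linarith [hx hii]
    have := partialSum_nonneg_of_no_alternation hs hs'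
      (fun a b c hab hbc ha hb hc => entropy_minimizer_no_alternation hM hmin hab hbc
        (sub_pos.1 ha) (sub_neg.1 hb) (sub_pos.1 hc))
      (fun a b c hab hbc ha hb hc => entropy_minimizer_no_alternation hM hmin hab hbc
        (sub_neg.1 ha) (sub_pos.1 hb) (sub_neg.1 hc)) k
    rw [sum_sub_distrib] at this
    exact sub_nonneg.1 this
  refine ⟨hord, fun i j k hij hjk => ?_⟩
  have hpw : ∀ i j, p i j = winProb (M i) (M j) := hp
  have dom : ∀ i j, 1 / 2 ≤ p i j → ∀ k ≤ n, initialMass (M i) k ≤ initialMass (M j) k := by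
    intro i j h
    rcases le_total j i with hji | hji
    · exact hord j i hji
    · rw [hpw] at h
      rw [eq_of_half_le_winProb (h1 i) (h1 j) (h0 i) (h0 j) (hord i j hji) h]
      exact fun _ _ => le_rfl
  simp only [hpw i j, hpw j k, hpw i k]
  refine max_le ?_ (winProb_le_of_initialMass_le (h1 j) (h1 i) (h0 k) (dom i j hij))
  have := winProb_le_of_initialMass_le (h1 k) (h1 j) (h0 i) (dom j k hjk)
  linarith [winProb_add_swap (h1 i) (h1 j), winProb_add_swap (h1 i) (h1 k)]
end

section
/- Let A be the set of triples (P(X<Y), P(Y<Z), P(Z<X)) ∈ [0,1]³, where X, Y, Z range over independent real random variables with P(X=Y) = P(Y=Z) = P(Z=X) = 0; equivalently, A = {((μ⊗ν)(x<y), (ν⊗ρ)(y<z), (ρ⊗μ)(z<x)) : μ, ν, ρ Borel probability measures on ℝ with (μ⊗ν)(x=y) = (ν⊗ρ)(y=z) = (ρ⊗μ)(z=x) = 0}. Then A = D. -/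
open MeasureTheory

/-- The function `α` of Steinhaus and Trybuła. -/
noncomputable def alphaST (ξ η : ℝ) : ℝ :=
  if 1 < ξ + η then max (max ((1 - ξ) / η) ((1 - η) / ξ)) (1 - ξ * η) else 1

/-- The region `D` of Steinhaus and Trybuła. -/
def DST : Set (ℝ × ℝ × ℝ) :=
  {t | t.1 ∈ Set.Icc (0 : ℝ) 1 ∧ t.2.1 ∈ Set.Icc (0 : ℝ) 1 ∧ t.2.2 ∈ Set.Icc (0 : ℝ) 1 ∧
    1 - alphaST (1 - t.1) (1 - t.2.1) ≤ t.2.2 ∧ t.2.2 ≤ alphaST t.1 t.2.1}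

/-- If `d` has mean zero and `g` has positive mean, then some convex combination of two values of
`(d, g)` has first coordinate zero and positive second coordinate. -/
theorem exists_pair_of_integral_pos {Ω : Type*} [MeasurableSpace Ω] (ν : Measure Ω) (d g : Ω → ℝ)
    (hd : Integrable d ν) (hd0 : ∫ y, d y ∂ν = 0) (hg : Integrable g ν)
    (hg0 : 0 < ∫ y, g y ∂ν) :
    ∃ y₁ y₂ : Ω, ∃ p : ℝ, 0 ≤ p ∧ p ≤ 1 ∧ (1 - p) * d y₁ + p * d y₂ = 0 ∧
      0 < (1 - p) * g y₁ + p * g y₂ := by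
  by_contra! h
  have hzero : ∀ y, d y = 0 → g y ≤ 0 := by
    intro y hy
    simpa using h y y 0 le_rfl zero_le_one (by simp [hy])
  have hslope : ∀ y₁ y₂, d y₁ < 0 → 0 < d y₂ → g y₂ / d y₂ ≤ g y₁ / d y₁ := by
    intro y₁ y₂ h1 h2
    have hpos : 0 < d y₂ - d y₁ := by linarith
    have := h y₁ y₂ (-d y₁ / (d y₂ - d y₁)) (div_nonneg (by linarith) hpos.le)
      ((div_le_one hpos).2 (by linarith)) (by field_simp; ring)
    have key : g y₁ * d y₂ - d y₁ * g y₂ ≤ 0 := by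
      have e : (1 - -d y₁ / (d y₂ - d y₁)) * g y₁ + -d y₁ / (d y₂ - d y₁) * g y₂
          = (g y₁ * d y₂ - d y₁ * g y₂) / (d y₂ - d y₁) := by field_simp; ring
      rw [e, div_le_iff₀ hpos] at this
      linarith
    rw [div_le_iff₀ h2, div_mul_eq_mul_div, le_div_iff_of_neg h1]
    linarith
  have hae : d =ᵐ[ν] 0 → False := by
    intro h0
    have : ∫ y, g y ∂ν ≤ 0 := integral_nonpos_of_ae (by
      filter_upwards [h0] with y hy using hzero y hy)
    linarith
  by_cases hR : ∃ y, 0 < d y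
  · by_cases hL : ∃ y, d y < 0
    · obtain ⟨yR, hyR⟩ := hR
      obtain ⟨yL, hyL⟩ := hL
      set S : Set ℝ := (fun y => g y / d y) '' {y | 0 < d y} with hS
      have hbdd : BddAbove S := ⟨g yL / d yL, by rintro _ ⟨y, hy, rfl⟩; exact hslope _ _ hyL hy⟩
      have hle : ∀ y, g y ≤ sSup S * d y := by
        intro y
        rcases lt_trichotomy (d y) 0 with hy | hy | hy
        · rw [← le_div_iff_of_neg hy]
          exact csSup_le ⟨_, yR, hyR, rfl⟩ (by rintro _ ⟨z, hz, rfl⟩; exact hslope _ _ hy hz)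
        · rw [hy, mul_zero]
          exact hzero y hy
        · rw [← div_le_iff₀ hy]
          exact le_csSup hbdd ⟨y, hy, rfl⟩
      have := integral_mono hg (hd.const_mul (sSup S)) hle
      rw [integral_const_mul, hd0] at this
      linarith
    · push Not at hL
      exact hae ((integral_eq_zero_iff_of_nonneg hL hd).1 hd0)
  · push Not at hR
    have h1 : (fun y => -d y) =ᵐ[ν] 0 :=
      (integral_eq_zero_iff_of_nonneg (fun y => neg_nonneg.2 (hR y)) hd.neg).1
        (by rw [integral_neg, hd0, neg_zero])
    exact hae (by filter_upwards [h1] with y hy using neg_eq_zero.1 hy)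

/-- One half of the two-point case: the second point has weight at most one half. -/
theorem two_point_bound_of_le {a b s t p q : ℝ} (ha : 0 ≤ a) (hb : 0 ≤ b) (hs : 0 ≤ s)
    (ht : 0 ≤ t) (has : a + s ≤ 1) (hbt : b + t ≤ 1) (hp : 0 ≤ p) (hq : 0 ≤ q) (hpq : p + q = 1)
    (hle : p ≤ q) (h : a * b + a * t + s * b < (a + p * s) * (b + q * t)) :
    a + p * s + (1 - (a * b + a * t + s * b)) * (b + q * t) ≤ 1 := by
  have hc : p * a * t + q * s * b < p * q * s * t := by
    obtain rfl : p = 1 - q := by linarith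
    nlinarith
  have h1 : 0 ≤ p * a * t := by positivity
  have h2 : 0 ≤ q * s * b := by positivity
  have hp0 : 0 < p := hp.lt_of_ne (by rintro rfl; simp at hc; linarith)
  have hq0 : 0 < q := hq.lt_of_ne (by rintro rfl; simp at hc; linarith)
  have hs0 : 0 < s := hs.lt_of_ne (by rintro rfl; simp at hc; linarith)
  have ht0 : 0 < t := ht.lt_of_ne (by rintro rfl; simp at hc; linarith)
  have hbp : b < p * t := by
    have : q * s * b < q * s * (p * t) := by linarith
    exact lt_of_mul_lt_mul_left this (by positivity)
  have hη0 : 0 ≤ b + q * t := by positivity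
  have hη1 : b + q * t ≤ 1 := by nlinarith
  have hp1 : p ≤ 1 := by linarith
  have hbp' : b * (b + q * t) ≤ p := by nlinarith
  -- the left side increases with `s`
  have hmono : a + p * s + (1 - (a * b + a * t + s * b)) * (b + q * t) ≤
      a + p * (1 - a) + (1 - (a * t + b)) * (b + q * t) := by
    nlinarith [mul_nonneg (sub_nonneg.2 has) (sub_nonneg.2 hbp')]
  have hstep : a ≤ q * (1 - a) * (1 - b) := by
    have h3 : a + q * s * b ≤ q * s := by
      have hpt : p * t ≤ 1 := by nlinarith
      have h4 : p * t * (a + q * s * b) ≤ p * t * (q * s) := by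
        have : p * t * (q * s * b) ≤ 1 * (q * s * b) := mul_le_mul_of_nonneg_right hpt h2
        linarith
      exact le_of_mul_le_mul_left h4 (by positivity)
    have : q * s * (1 - b) ≤ q * (1 - a) * (1 - b) := by
      have : s ≤ 1 - a := by linarith
      have : 0 ≤ 1 - b := by linarith
      gcongr
    linarith
  have hr : 0 ≤ 1 - b - t := by linarith
  have hlast : (1 - (a * t + b)) * (b + q * t) ≤ q * (1 - a) := by
    have e : q * (1 - a) - (1 - (a * t + b)) * (b + q * t) =
        (1 - a) * (q - (1 - b) * (b + q * (1 - b))) +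
        (1 - b - t) * (q * (1 - a) * (1 - b) - a * (b + q * (1 - b)) + q * a * (1 - b - t)) := by
      ring
    have h5 : 0 ≤ q - (1 - b) * (b + q * (1 - b)) := by
      have : q - (1 - b) * (b + q * (1 - b)) = b * (q - p + b * p) := by
        obtain rfl : p = 1 - q := by linarith
        ring
      rw [this]
      have : 0 ≤ q - p := by linarith
      positivity
    have h6 : a * (b + q * (1 - b)) ≤ a :=
      mul_le_of_le_one_right ha (by nlinarith [mul_nonneg hp (by linarith : 0 ≤ 1 - b)])
    have h7 : 0 ≤ q * a * (1 - b - t) := by positivity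
    have h8 : 0 ≤ 1 - a := by linarith
    nlinarith [mul_nonneg h8 h5, mul_nonneg hr (by linarith :
      0 ≤ q * (1 - a) * (1 - b) - a * (b + q * (1 - b)) + q * a * (1 - b - t))]
  obtain rfl : p = 1 - q := by linarith
  linarith

/-- The upper bound when the middle variable takes two values. -/
theorem two_point_bound {a₁ a₂ b₁ b₂ p : ℝ} (ha : 0 ≤ a₁) (ha' : a₁ ≤ a₂) (ha'' : a₂ ≤ 1)
    (hb : 0 ≤ b₂) (hb' : b₂ ≤ b₁) (hb'' : b₁ ≤ 1) (hp : 0 ≤ p) (hp' : p ≤ 1) {w : ℝ}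
    (hw : a₁ * b₁ + a₂ * b₂ - a₁ * b₂ ≤ w)
    (h : w < ((1 - p) * a₁ + p * a₂) * ((1 - p) * b₁ + p * b₂)) :
    (1 - p) * a₁ + p * a₂ + (1 - w) * ((1 - p) * b₁ + p * b₂) ≤ 1 ∨
    (1 - p) * b₁ + p * b₂ + (1 - w) * ((1 - p) * a₁ + p * a₂) ≤ 1 := by
  have hA : 0 ≤ (1 - p) * a₁ + p * a₂ :=
    add_nonneg (mul_nonneg (by linarith) ha) (mul_nonneg hp (by linarith))
  have hB : 0 ≤ (1 - p) * b₁ + p * b₂ :=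
    add_nonneg (mul_nonneg (by linarith) (by linarith)) (mul_nonneg hp hb)
  rcases le_total p (1 - p) with hle | hle
  · left
    have := two_point_bound_of_le (a := a₁) (b := b₂) (s := a₂ - a₁) (t := b₁ - b₂) (p := p)
      (q := 1 - p) ha hb (by linarith) (by linarith) (by linarith) (by linarith) hp (by linarith)
      (by ring) hle (by nlinarith)
    nlinarith [mul_le_mul_of_nonneg_right hw hB]
  · right
    have := two_point_bound_of_le (a := b₂) (b := a₁) (s := b₁ - b₂) (t := a₂ - a₁) (p := 1 - p)
      (q := p) hb ha (by linarith) (by linarith) (by linarith) (by linarith) (by linarith) hp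
      (by ring) hle (by nlinarith)
    nlinarith [mul_le_mul_of_nonneg_right hw hA]

theorem measureReal_prod_lt_eq_integral_Iio (μ ν : Measure ℝ) [IsProbabilityMeasure μ]
    [IsProbabilityMeasure ν] :
    (μ.prod ν).real {q : ℝ × ℝ | q.1 < q.2} = ∫ y, μ.real (Set.Iio y) ∂ν := by
  rw [measureReal_def, Measure.prod_apply_symm (measurableSet_lt measurable_fst measurable_snd),
    ← integral_toReal]
  · rfl
  · exact (measurable_measure_prodMk_right
      (measurableSet_lt measurable_fst measurable_snd)).aemeasurable
  · exact ae_of_all _ fun _ => measure_lt_top _ _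

theorem measureReal_prod_lt_eq_integral_Ioi (ν ρ : Measure ℝ) [IsProbabilityMeasure ν]
    [IsProbabilityMeasure ρ] :
    (ν.prod ρ).real {q : ℝ × ℝ | q.1 < q.2} = ∫ y, ρ.real (Set.Ioi y) ∂ν := by
  rw [measureReal_def, Measure.prod_apply (measurableSet_lt measurable_fst measurable_snd),
    ← integral_toReal]
  · rfl
  · exact (measurable_measure_prodMk_left
      (measurableSet_lt measurable_fst measurable_snd)).aemeasurable
  · exact ae_of_all _ fun _ => measure_lt_top _ _

theorem le_measureReal_prod_lt (μ ρ : Measure ℝ) [IsProbabilityMeasure μ]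
    [IsProbabilityMeasure ρ] {y₁ y₂ : ℝ} (h : y₁ ≤ y₂) :
    μ.real (Set.Iio y₁) * ρ.real (Set.Ioi y₁) + μ.real (Set.Iio y₂) * ρ.real (Set.Ioi y₂) -
      μ.real (Set.Iio y₁) * ρ.real (Set.Ioi y₂) ≤
      (μ.prod ρ).real {q : ℝ × ℝ | q.1 < q.2} := by
  have hinter : (Set.Iio y₁ ×ˢ Set.Ioi y₁) ∩ (Set.Iio y₂ ×ˢ Set.Ioi y₂) =
      Set.Iio y₁ ×ˢ Set.Ioi y₂ := by
    rw [Set.prod_inter_prod, Set.Iio_inter_Iio, Set.Ioi_inter_Ioi, inf_of_le_left h,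
      sup_of_le_right h]
  have hunion := measureReal_union_add_inter (μ := μ.prod ρ) (s := Set.Iio y₁ ×ˢ Set.Ioi y₁)
    (t := Set.Iio y₂ ×ˢ Set.Ioi y₂) (measurableSet_Iio.prod measurableSet_Ioi)
  rw [hinter, measureReal_prod_prod, measureReal_prod_prod, measureReal_prod_prod] at hunion
  rw [← hunion, add_sub_cancel_right]
  refine measureReal_mono ?_
  rintro ⟨x, z⟩ (⟨hx, hz⟩ | ⟨hx, hz⟩)
  · exact lt_trans (Set.mem_Iio.1 hx) (Set.mem_Ioi.1 hz)
  · exact lt_trans (Set.mem_Iio.1 hx) (Set.mem_Ioi.1 hz)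

/-- The pair `(P(X < Y), P(Y < Z))` cannot be too large compared with `P(X < Z)`. -/
theorem transitive_bound (μ ν ρ : Measure ℝ) [IsProbabilityMeasure μ] [IsProbabilityMeasure ν]
    [IsProbabilityMeasure ρ] {ξ η w : ℝ} (hξ : (μ.prod ν).real {q : ℝ × ℝ | q.1 < q.2} = ξ)
    (hη : (ν.prod ρ).real {q : ℝ × ℝ | q.1 < q.2} = η)
    (hw : (μ.prod ρ).real {q : ℝ × ℝ | q.1 < q.2} = w) :
    ξ + (1 - w) * η ≤ 1 ∨ η + (1 - w) * ξ ≤ 1 ∨ ξ * η ≤ w := by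
  by_contra! hbad
  obtain ⟨hbad₁, hbad₂, hbad₃⟩ := hbad
  have hw0 : 0 ≤ w := hw ▸ measureReal_nonneg
  have hw1 : w ≤ 1 := hw ▸ measureReal_le_one
  have hξ0 : 0 < ξ := (hξ ▸ measureReal_nonneg : 0 ≤ ξ).lt_of_ne
    (by rintro rfl; simp at hbad₃; linarith)
  have hη0 : 0 < η := (hη ▸ measureReal_nonneg : 0 ≤ η).lt_of_ne
    (by rintro rfl; simp at hbad₃; linarith)
  obtain ⟨ε, hε, hε₀, hε₀', hε₁, hε₂, hε₃⟩ : ∃ ε : ℝ, 0 < ε ∧ 0 < ξ - ε ∧ 0 < η - ε ∧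
      1 < (ξ - ε) + (1 - w) * (η - ε) ∧ 1 < (η - ε) + (1 - w) * (ξ - ε) ∧
      w < (ξ - ε) * (η - ε) := by
    have key : ∀ f : ℝ → ℝ, Continuous f → ∀ c, c < f 0 →
        ∀ᶠ ε in nhdsWithin (0 : ℝ) (Set.Ioi 0), c < f ε := fun f hf c hc =>
      (hf.continuousAt.eventually (lt_mem_nhds hc)).filter_mono nhdsWithin_le_nhds
    have := (((((key (fun ε => ξ - ε) (by fun_prop) 0 (by simpa)).and
      (key (fun ε => η - ε) (by fun_prop) 0 (by simpa))).and
      (key (fun ε => (ξ - ε) + (1 - w) * (η - ε)) (by fun_prop) 1 (by simpa))).and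
      (key (fun ε => (η - ε) + (1 - w) * (ξ - ε)) (by fun_prop) 1 (by simpa))).and
      (key (fun ε => (ξ - ε) * (η - ε)) (by fun_prop) w (by simpa))).and self_mem_nhdsWithin
    obtain ⟨ε, ⟨⟨⟨⟨h1, h2⟩, h3⟩, h4⟩, h5⟩, h6⟩ := this.exists
    exact ⟨ε, h6, h1, h2, h3, h4, h5⟩
  set a : ℝ → ℝ := fun y => μ.real (Set.Iio y) with ha
  set b : ℝ → ℝ := fun y => ρ.real (Set.Ioi y) with hb
  have ha_mono : Monotone a := fun x y h => measureReal_mono (Set.Iio_subset_Iio h)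
  have hb_anti : Antitone b := fun x y h => measureReal_mono (Set.Ioi_subset_Ioi h)
  have ha_int : Integrable a ν := Integrable.of_bound ha_mono.measurable.aestronglyMeasurable 1
    (ae_of_all _ fun y => by
      rw [Real.norm_of_nonneg measureReal_nonneg]; exact measureReal_le_one)
  have hb_int : Integrable b ν := Integrable.of_bound hb_anti.measurable.aestronglyMeasurable 1
    (ae_of_all _ fun y => by
      rw [Real.norm_of_nonneg measureReal_nonneg]; exact measureReal_le_one)
  have ha_mean : ∫ y, a y ∂ν = ξ := by rw [← hξ, measureReal_prod_lt_eq_integral_Iio]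
  have hb_mean : ∫ y, b y ∂ν = η := by rw [← hη, measureReal_prod_lt_eq_integral_Ioi]
  have hpair : ∃ y₁ y₂ p : ℝ, y₁ ≤ y₂ ∧ 0 ≤ p ∧ p ≤ 1 ∧
      ξ - ε < (1 - p) * a y₁ + p * a y₂ ∧ η - ε < (1 - p) * b y₁ + p * b y₂ := by
    have hab : Integrable (fun y => a y - b y) ν := ha_int.sub hb_int
    have hab' : Integrable (fun y => a y + b y) ν := ha_int.add hb_int
    obtain ⟨y₁, y₂, p, hp, hp', hd, hg⟩ := exists_pair_of_integral_pos ν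
      (fun y => a y - b y - (ξ - η)) (fun y => a y + b y - (ξ + η - 2 * ε))
      (hab.sub (integrable_const _))
      (by rw [integral_sub hab (integrable_const _), integral_sub ha_int hb_int]
          simp [ha_mean, hb_mean])
      (hab'.sub (integrable_const _))
      (by rw [integral_sub hab' (integrable_const _), integral_add ha_int hb_int]
          simp [ha_mean, hb_mean, hε])
    rcases le_total y₁ y₂ with h | h
    · exact ⟨y₁, y₂, p, h, hp, hp', by linarith, by linarith⟩
    · exact ⟨y₂, y₁, 1 - p, h, by linarith, by linarith, by linarith, by linarith⟩
  obtain ⟨y₁, y₂, p, hy, hp, hp', hA, hB⟩ := hpair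
  have hprod : w < ((1 - p) * a y₁ + p * a y₂) * ((1 - p) * b y₁ + p * b y₂) :=
    hε₃.trans_le (mul_le_mul hA.le hB.le hε₀'.le (hε₀.le.trans hA.le))
  have hw1' : 0 ≤ 1 - w := by linarith
  rcases two_point_bound (measureReal_nonneg (μ := μ)) (ha_mono hy) measureReal_le_one
    (measureReal_nonneg (μ := ρ)) (hb_anti hy) measureReal_le_one hp hp'
    (hw ▸ le_measureReal_prod_lt μ ρ hy) hprod with h | h
  · linarith [mul_le_mul_of_nonneg_left hB.le hw1']
  · linarith [mul_le_mul_of_nonneg_left hA.le hw1']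

theorem alphaST_comm (ξ η : ℝ) : alphaST ξ η = alphaST η ξ := by
  unfold alphaST
  rw [add_comm, max_comm ((1 - ξ) / η), mul_comm]

theorem prod_eq_null_comm {μ ρ : Measure ℝ} [IsProbabilityMeasure μ] [IsProbabilityMeasure ρ]
    (h : (ρ.prod μ) {q : ℝ × ℝ | q.1 = q.2} = 0) : (μ.prod ρ) {q : ℝ × ℝ | q.1 = q.2} = 0 := by
  rw [← Measure.prod_swap, Measure.map_apply measurable_swap
    (measurableSet_eq_fun measurable_fst measurable_snd), ← h]
  congr 1
  ext q
  exact eq_comm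

theorem measureReal_prod_gt (μ ρ : Measure ℝ) [IsProbabilityMeasure μ] [IsProbabilityMeasure ρ]
    (h : (ρ.prod μ) {q : ℝ × ℝ | q.1 = q.2} = 0) :
    (μ.prod ρ).real {q : ℝ × ℝ | q.1 < q.2} = 1 - (ρ.prod μ).real {q : ℝ × ℝ | q.1 < q.2} := by
  have hswap : (μ.prod ρ).real {q : ℝ × ℝ | q.1 < q.2} =
      (ρ.prod μ).real {q : ℝ × ℝ | q.2 < q.1} := by
    rw [← Measure.prod_swap, measureReal_def, Measure.map_apply measurable_swap
      (measurableSet_lt measurable_fst measurable_snd)]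
    rfl
  have hcompl : {q : ℝ × ℝ | q.1 < q.2}ᶜ = {q : ℝ × ℝ | q.2 < q.1} ∪ {q | q.1 = q.2} := by
    ext q
    simp [le_iff_lt_or_eq, eq_comm]
  rw [hswap, ← probReal_compl_eq_one_sub (measurableSet_lt measurable_fst measurable_snd), hcompl,
    measureReal_def, measureReal_def,
    measure_congr (union_ae_eq_left_of_ae_eq_empty (ae_eq_empty.2 h))]

theorem le_alphaST (μ ν ρ : Measure ℝ) [IsProbabilityMeasure μ] [IsProbabilityMeasure ν]
    [IsProbabilityMeasure ρ] (h : (ρ.prod μ) {q : ℝ × ℝ | q.1 = q.2} = 0) :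
    (ρ.prod μ).real {q : ℝ × ℝ | q.1 < q.2} ≤
      alphaST ((μ.prod ν).real {q : ℝ × ℝ | q.1 < q.2})
        ((ν.prod ρ).real {q : ℝ × ℝ | q.1 < q.2}) := by
  have hbound := transitive_bound μ ν ρ rfl rfl rfl
  rw [measureReal_prod_gt μ ρ h, sub_sub_cancel] at hbound
  set ξ := (μ.prod ν).real {q : ℝ × ℝ | q.1 < q.2}
  set η := (ν.prod ρ).real {q : ℝ × ℝ | q.1 < q.2}
  have hξ : ξ ≤ 1 := measureReal_le_one
  have hη : η ≤ 1 := measureReal_le_one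
  unfold alphaST
  split_ifs with hsum
  · rw [le_max_iff, le_max_iff, le_div_iff₀ (by linarith), le_div_iff₀ (by linarith)]
    rcases hbound with h | h | h
    · exact .inl (.inl (by linarith))
    · exact .inl (.inr (by linarith))
    · exact .inr (by linarith)
  · exact measureReal_le_one

/-- The triples of winning probabilities of three independent variables without ties. -/
def CyclicTriple (ξ η ζ : ℝ) : Prop :=
  ∃ μ ν ρ : Measure ℝ,
    IsProbabilityMeasure μ ∧ IsProbabilityMeasure ν ∧ IsProbabilityMeasure ρ ∧
    (μ.prod ν) {q : ℝ × ℝ | q.1 = q.2} = 0 ∧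
    (ν.prod ρ) {q : ℝ × ℝ | q.1 = q.2} = 0 ∧
    (ρ.prod μ) {q : ℝ × ℝ | q.1 = q.2} = 0 ∧
    (ξ, η, ζ) = (((μ.prod ν) {q : ℝ × ℝ | q.1 < q.2}).toReal,
      ((ν.prod ρ) {q : ℝ × ℝ | q.1 < q.2}).toReal,
      ((ρ.prod μ) {q : ℝ × ℝ | q.1 < q.2}).toReal)

theorem CyclicTriple.rotate {ξ η ζ : ℝ} (h : CyclicTriple ξ η ζ) : CyclicTriple η ζ ξ := by
  obtain ⟨μ, ν, ρ, hμ, hν, hρ, h1, h2, h3, h⟩ := h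
  simp only [Prod.mk.injEq] at h
  exact ⟨ν, ρ, μ, hν, hρ, hμ, h2, h3, h1, by simp [h]⟩

/-- Triples realized with a constant middle variable. -/
theorem cyclicTriple_of_mem_Icc {ξ η ζ : ℝ} (hξ : ξ ∈ Set.Icc (0 : ℝ) 1)
    (hη : η ∈ Set.Icc (0 : ℝ) 1) (hζ : (1 - ξ) * (1 - η) ≤ ζ) (hζ' : ζ ≤ 1 - ξ * η) :
    CyclicTriple ξ η ζ := by
  obtain ⟨hξ0, hξ1⟩ := hξ
  obtain ⟨hη0, hη1⟩ := hη
  obtain ⟨θ, hθ0, hθ1, rfl⟩ : ∃ θ : ℝ, 0 ≤ θ ∧ θ ≤ 1 ∧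
      ζ = (1 - ξ) * (1 - η) + θ * (ξ * (1 - η) + (1 - ξ) * η) := by
    have hm : 0 ≤ ξ * (1 - η) + (1 - ξ) * η :=
      add_nonneg (mul_nonneg hξ0 (by linarith)) (mul_nonneg (by linarith) hη0)
    rcases hm.eq_or_lt with h0 | h0
    · exact ⟨0, le_rfl, zero_le_one, by linarith⟩
    · exact ⟨(ζ - (1 - ξ) * (1 - η)) / (ξ * (1 - η) + (1 - ξ) * η),
        div_nonneg (by linarith) h0.le, (div_le_one h0).2 (by linarith), by field_simp; ring⟩
  have h1 : 0 ≤ 1 - ξ := by linarith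
  have h2 : 0 ≤ 1 - η := by linarith
  have h3 : 0 ≤ 1 - θ := by linarith
  have hsξ : ENNReal.ofReal ξ + ENNReal.ofReal (1 - ξ) = 1 := by
    rw [← ENNReal.ofReal_add hξ0 h1]; simp
  have hsη : ENNReal.ofReal ((1 - η) * θ) + ENNReal.ofReal ((1 - η) * (1 - θ)) +
      ENNReal.ofReal (η * θ) + ENNReal.ofReal (η * (1 - θ)) = 1 := by
    rw [← ENNReal.ofReal_add (by positivity) (by positivity),
      ← ENNReal.ofReal_add (by positivity) (by positivity),
      ← ENNReal.ofReal_add (by positivity) (by positivity), ← ENNReal.ofReal_one]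
    congr 1
    ring
  have hlt : MeasurableSet {q : ℝ × ℝ | q.1 < q.2} :=
    measurableSet_lt measurable_fst measurable_snd
  have heq : MeasurableSet {q : ℝ × ℝ | q.1 = q.2} :=
    measurableSet_eq_fun measurable_fst measurable_snd
  refine ⟨ENNReal.ofReal ξ • Measure.dirac (-2) + ENNReal.ofReal (1 - ξ) • Measure.dirac 2,
    Measure.dirac 0,
    ENNReal.ofReal ((1 - η) * θ) • Measure.dirac (-3) +
      ENNReal.ofReal ((1 - η) * (1 - θ)) • Measure.dirac (-1) +
      ENNReal.ofReal (η * θ) • Measure.dirac 1 + ENNReal.ofReal (η * (1 - θ)) • Measure.dirac 3,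
    ⟨by simpa using hsξ⟩, inferInstance, ⟨by simpa using hsη⟩, ?_, ?_, ?_, ?_⟩
  · rw [Measure.prod_apply heq]
    simp
  · rw [Measure.prod_apply heq]
    simp
  · rw [Measure.prod_apply heq]
    simp [Set.indicator]
    norm_num
  · simp only [Measure.prod_apply hlt]
    simp [Set.indicator]
    norm_num
    refine ⟨(ENNReal.toReal_ofReal hξ0).symm, ?_, ?_⟩
    · rw [← ENNReal.ofReal_add (by positivity) (by positivity),
        ENNReal.toReal_ofReal (by positivity)]
      ring
    · rw [hsξ, mul_one]
      repeat rw [← ENNReal.ofReal_mul (by positivity)]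
      repeat rw [← ENNReal.ofReal_add (by positivity) (by positivity)]
      rw [ENNReal.toReal_ofReal (by positivity)]
      ring

/-- Each of the conditions is sufficient for one of the variables to be taken constant. -/
theorem cyclicTriple_of_or {ξ η ζ : ℝ} (hξ : ξ ∈ Set.Icc (0 : ℝ) 1)
    (hη : η ∈ Set.Icc (0 : ℝ) 1) (hζ : ζ ∈ Set.Icc (0 : ℝ) 1)
    (h : ((1 - ξ) * (1 - η) ≤ ζ ∧ ζ ≤ 1 - ξ * η) ∨ ((1 - η) * (1 - ζ) ≤ ξ ∧ ξ ≤ 1 - η * ζ) ∨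
      ((1 - ζ) * (1 - ξ) ≤ η ∧ η ≤ 1 - ζ * ξ)) : CyclicTriple ξ η ζ := by
  rcases h with h | h | h
  · exact cyclicTriple_of_mem_Icc hξ hη h.1 h.2
  · exact (cyclicTriple_of_mem_Icc hη hζ h.1 h.2).rotate.rotate
  · exact (cyclicTriple_of_mem_Icc hζ hξ h.1 h.2).rotate

/-- Below the graph of `alphaST` over `ξ + η ≥ 1`, one of the variables can be taken constant. -/
theorem or_of_le_alphaST {ξ η ζ : ℝ} (hξ : ξ ∈ Set.Icc (0 : ℝ) 1)
    (hη : η ∈ Set.Icc (0 : ℝ) 1) (hζ : ζ ∈ Set.Icc (0 : ℝ) 1) (hsum : 1 ≤ ξ + η)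
    (hα : ζ ≤ alphaST ξ η) :
    ((1 - ξ) * (1 - η) ≤ ζ ∧ ζ ≤ 1 - ξ * η) ∨ ((1 - η) * (1 - ζ) ≤ ξ ∧ ξ ≤ 1 - η * ζ) ∨
      ((1 - ζ) * (1 - ξ) ≤ η ∧ η ≤ 1 - ζ * ξ) := by
  obtain ⟨hξ0, hξ1⟩ := hξ
  obtain ⟨hη0, hη1⟩ := hη
  obtain ⟨hζ0, hζ1⟩ := hζ
  have hZ : (1 - η) * (1 - ζ) ≤ ξ := by nlinarith
  have hX : (1 - ζ) * (1 - ξ) ≤ η := by nlinarith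
  unfold alphaST at hα
  split_ifs at hα with hlt
  · rw [le_max_iff, le_max_iff, le_div_iff₀ (by linarith), le_div_iff₀ (by linarith)] at hα
    rcases hα with (h | h) | h
    · exact .inr (.inl ⟨hZ, by linarith⟩)
    · exact .inr (.inr ⟨hX, by linarith⟩)
    · rcases le_total ((1 - ξ) * (1 - η)) ζ with h' | h'
      · exact .inl ⟨h', h⟩
      · refine .inr (.inl ⟨hZ, ?_⟩)
        nlinarith [mul_nonneg (sub_nonneg.2 hξ1) (sub_nonneg.2 hη1)]
  · refine .inr (.inl ⟨hZ, ?_⟩)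
    nlinarith

/-- **Steinhaus–Trybuła theorem.** The set of triples
`(P(X<Y), P(Y<Z), P(Z<X))` over independent real random variables with
pairwise zero tie probabilities equals `D`. -/
theorem steinhaus_trybula :
    {t : ℝ × ℝ × ℝ | ∃ μ ν ρ : Measure ℝ,
      IsProbabilityMeasure μ ∧ IsProbabilityMeasure ν ∧ IsProbabilityMeasure ρ ∧
      (μ.prod ν) {q : ℝ × ℝ | q.1 = q.2} = 0 ∧
      (ν.prod ρ) {q : ℝ × ℝ | q.1 = q.2} = 0 ∧
      (ρ.prod μ) {q : ℝ × ℝ | q.1 = q.2} = 0 ∧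
      t = (((μ.prod ν) {q : ℝ × ℝ | q.1 < q.2}).toReal,
           ((ν.prod ρ) {q : ℝ × ℝ | q.1 < q.2}).toReal,
           ((ρ.prod μ) {q : ℝ × ℝ | q.1 < q.2}).toReal)} = DST := by
  ext ⟨ξ, η, ζ⟩
  constructor
  · rintro ⟨μ, ν, ρ, hμ, hν, hρ, h1, h2, h3, h⟩
    simp only [Prod.mk.injEq] at h
    obtain ⟨hξ, hη, hζ⟩ := h
    rw [← measureReal_def] at hξ hη hζ
    have hupper := le_alphaST μ ν ρ h3
    have hlower := le_alphaST ρ ν μ (prod_eq_null_comm h3)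
    rw [measureReal_prod_gt μ ρ h3, measureReal_prod_gt ν μ h1, measureReal_prod_gt ρ ν h2,
      alphaST_comm, ← hξ, ← hη, ← hζ] at hlower
    rw [← hξ, ← hη, ← hζ] at hupper
    refine ⟨?_, ?_, ?_, ?_, hupper⟩
    · exact hξ ▸ ⟨measureReal_nonneg, measureReal_le_one⟩
    · exact hη ▸ ⟨measureReal_nonneg, measureReal_le_one⟩
    · exact hζ ▸ ⟨measureReal_nonneg, measureReal_le_one⟩
    · dsimp only
      linarith
  · rintro ⟨hξ, hη, hζ, hlower, hupper⟩
    dsimp only at hξ hη hζ hlower hupper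
    refine cyclicTriple_of_or hξ hη hζ ?_
    rcases le_total 1 (ξ + η) with hsum | hsum
    · exact or_of_le_alphaST hξ hη hζ hsum hupper
    · have := or_of_le_alphaST (ξ := 1 - ξ) (η := 1 - η) (ζ := 1 - ζ)
        (Set.Icc.mem_iff_one_sub_mem.1 hξ) (Set.Icc.mem_iff_one_sub_mem.1 hη)
        (Set.Icc.mem_iff_one_sub_mem.1 hζ) (by linarith) (by linarith)
      simp only [sub_sub_cancel] at this
      rcases this with h | h | h
      · exact .inl ⟨by linarith, by linarith⟩
      · exact .inr (.inl ⟨by linarith, by linarith⟩)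
      · exact .inr (.inr ⟨by linarith, by linarith⟩)
end
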